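/- Let E ⊂ ℝ be a Borel set and fix x ∈ ℝ. Then the following are equivalent: (a) μ({x}) = 0 for every positive Borel measure μ that is reflectionless on E (μ ∈ R(E)); (b) ∫_{x−1}^{x+1} χ_E(t)/|t−x| dt = ∞. -/

import Mathlib

open MeasureTheory Filter Topology

/-- The Herglotz function associated with a positive Borel measure `μ` on `ℝ`
(satisfying `∫ dμ(t)/(t²+1) < ∞`) and constants `a ∈ ℝ`, `b ≥ 0`:
`F(z) = a + b z + ∫ (1/(t - z) - t/(t² + 1)) dμ(t)`. -/
noncomputable def herglotzFn (μ : Measure ℝ) (a b : ℝ) (z : ℂ) : ℂ :=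
  (a : ℂ) + (b : ℂ) * z +
    ∫ t : ℝ, (((t : ℂ) - z)⁻¹ - (t : ℂ) / ((t : ℂ) ^ 2 + 1)) ∂μ

/-- `μ ∈ R(E)`: the measure `μ` satisfies `∫ dμ(t)/(t²+1) < ∞` and for some choice of
`a ∈ ℝ`, `b ≥ 0` the associated Herglotz function `F_μ` is reflectionless on `E`, i.e.
its boundary value has vanishing real part at Lebesgue-a.e. point of `E`. -/
def IsReflectionless (μ : Measure ℝ) (E : Set ℝ) : Prop :=
  Integrable (fun t : ℝ => (t ^ 2 + 1)⁻¹) μ ∧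
  ∃ a b : ℝ, 0 ≤ b ∧
    ∀ᵐ t : ℝ ∂(volume.restrict E),
      Tendsto (fun y : ℝ => (herglotzFn μ a b ((t : ℂ) + y * Complex.I)).re)
        (𝓝[>] (0 : ℝ)) (𝓝 0)

/-- The Cauchy transform `z ↦ ∫ dν(s)/(s - z)` of a measure on the real line. -/
noncomputable def cauchyTransform (ν : Measure ℝ) (z : ℂ) : ℂ :=
  ∫ s : ℝ, ((s : ℂ) - z)⁻¹ ∂ν

lemma measurable_inv_ofReal_sub (z : ℂ) : Measurable fun s : ℝ => ((s : ℂ) - z)⁻¹ :=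
  (Complex.measurable_ofReal.sub_const z).inv

lemma im_le_norm_ofReal_sub (s : ℝ) (z : ℂ) : z.im ≤ ‖(s : ℂ) - z‖ := by
  have h := Complex.abs_im_le_norm ((s : ℂ) - z)
  simp only [Complex.sub_im, Complex.ofReal_im, zero_sub, abs_neg] at h
  exact (le_abs_self _).trans h

lemma abs_sub_re_le_norm_ofReal_sub (s : ℝ) (z : ℂ) : |s - z.re| ≤ ‖(s : ℂ) - z‖ := by
  simpa using Complex.abs_re_le_norm ((s : ℂ) - z)

section CauchyTransform

variable {ν : Measure ℝ} [IsFiniteMeasure ν] {z : ℂ} {δ : ℝ}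

lemma integrable_inv_ofReal_sub (hδ : 0 < δ) (h : ∀ᵐ s : ℝ ∂ν, δ ≤ ‖(s : ℂ) - z‖) :
    Integrable (fun s : ℝ => ((s : ℂ) - z)⁻¹) ν := by
  refine Integrable.of_bound (measurable_inv_ofReal_sub z).aestronglyMeasurable δ⁻¹ ?_
  filter_upwards [h] with s hs
  rw [norm_inv]
  gcongr

lemma norm_cauchyTransform_le (hδ : 0 < δ) (h : ∀ᵐ s : ℝ ∂ν, δ ≤ ‖(s : ℂ) - z‖) :
    ‖cauchyTransform ν z‖ ≤ ν.real Set.univ / δ := by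
  rw [div_eq_inv_mul]
  refine norm_integral_le_of_norm_le_const ?_
  filter_upwards [h] with s hs
  rw [norm_inv]
  gcongr

lemma differentiableAt_cauchyTransform (hδ : 0 < δ) (h : ∀ᵐ s : ℝ ∂ν, δ ≤ ‖(s : ℂ) - z‖) :
    DifferentiableAt ℂ (cauchyTransform ν) z := by
  have key : ∀ (s : ℝ), δ ≤ ‖(s : ℂ) - z‖ → ∀ w ∈ Metric.ball z (δ / 2),
      δ / 2 ≤ ‖(s : ℂ) - w‖ := by
    intro s hs w hw
    have h1 : ‖w - z‖ < δ / 2 := by simpa [dist_eq_norm] using hw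
    have h2 : ‖(s : ℂ) - z‖ ≤ ‖(s : ℂ) - w‖ + ‖w - z‖ := norm_sub_le_norm_sub_add_norm_sub _ _ _
    linarith
  refine (hasDerivAt_integral_of_dominated_loc_of_deriv_le (𝕜 := ℂ)
    (F := fun w (s : ℝ) => ((s : ℂ) - w)⁻¹) (F' := fun w (s : ℝ) => (((s : ℂ) - w) ^ 2)⁻¹)
    (bound := fun _ => ((δ / 2) ^ 2)⁻¹)
    (Metric.ball_mem_nhds z (half_pos hδ)) ?_ (integrable_inv_ofReal_sub hδ h) ?_ ?_
    (integrable_const _) ?_).2.differentiableAt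
  · exact Eventually.of_forall fun w => (measurable_inv_ofReal_sub w).aestronglyMeasurable
  · exact ((Complex.measurable_ofReal.sub_const z).pow_const 2).inv.aestronglyMeasurable
  · filter_upwards [h] with s hs w hw
    rw [norm_inv, norm_pow]
    have := key s hs w hw
    gcongr
  · filter_upwards [h] with s hs w hw
    have h1 := key s hs w hw
    have h0 : (s : ℂ) - w ≠ 0 := by
      intro h0
      rw [h0, norm_zero] at h1
      linarith
    exact (((hasDerivAt_id' w).const_sub (s : ℂ)).fun_inv h0).congr_deriv (by simp)

lemma differentiableOn_cauchyTransform :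
    DifferentiableOn ℂ (cauchyTransform ν) {z | 0 < z.im} := fun z hz =>
  (differentiableAt_cauchyTransform hz
    (Eventually.of_forall fun s => im_le_norm_ofReal_sub s z)).differentiableWithinAt

lemma inv_ofReal_sub_im (s : ℝ) (z : ℂ) :
    (((s : ℂ) - z)⁻¹).im = z.im / ((s - z.re) ^ 2 + z.im ^ 2) := by
  simp [Complex.inv_im, Complex.normSq_apply, pow_two]

lemma inv_ofReal_sub_re (s : ℝ) (z : ℂ) :
    (((s : ℂ) - z)⁻¹).re = (s - z.re) / ((s - z.re) ^ 2 + z.im ^ 2) := by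
  simp [Complex.inv_re, Complex.normSq_apply, pow_two]

lemma cauchyTransform_im (hδ : 0 < δ) (h : ∀ᵐ s : ℝ ∂ν, δ ≤ ‖(s : ℂ) - z‖) :
    (cauchyTransform ν z).im = ∫ s, z.im / ((s - z.re) ^ 2 + z.im ^ 2) ∂ν := by
  simp_rw [← inv_ofReal_sub_im]
  exact (integral_im (integrable_inv_ofReal_sub hδ h)).symm

lemma cauchyTransform_re (hδ : 0 < δ) (h : ∀ᵐ s : ℝ ∂ν, δ ≤ ‖(s : ℂ) - z‖) :
    (cauchyTransform ν z).re = ∫ s, (s - z.re) / ((s - z.re) ^ 2 + z.im ^ 2) ∂ν := by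
  simp_rw [← inv_ofReal_sub_re]
  exact (integral_re (integrable_inv_ofReal_sub hδ h)).symm

lemma cauchyTransform_im_nonneg (hz : 0 < z.im) : 0 ≤ (cauchyTransform ν z).im := by
  rw [cauchyTransform_im hz (Eventually.of_forall fun s => im_le_norm_ofReal_sub s z)]
  exact integral_nonneg fun s => by positivity

/-- The Kolmogorov function `w ↦ w / (w + i l)` has nonnegative real part on the closed upper
half plane. -/
lemma re_div_add_mul_I_nonneg {l : ℝ} (hl : 0 < l) {w : ℂ} (hw : 0 ≤ w.im) :
    0 ≤ (w / (w + l * Complex.I)).re := by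
  rw [Complex.div_re]
  simp only [Complex.add_re, Complex.add_im, Complex.mul_re, Complex.mul_im, Complex.ofReal_re,
    Complex.ofReal_im, Complex.I_re, Complex.I_im]
  ring_nf
  have := Complex.normSq_nonneg (w + l * Complex.I)
  positivity

/-- The Kolmogorov function `w ↦ w / (w + i l)` has real part at least `1/2` where
`l ≤ |Re w|`. -/
lemma half_le_re_div_add_mul_I {l : ℝ} (hl : 0 < l) {w : ℂ} (hw : 0 ≤ w.im) (h : l ≤ |w.re|) :
    1 / 2 ≤ (w / (w + l * Complex.I)).re := by
  have h2 : l ^ 2 ≤ w.re ^ 2 := by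
    rw [← sq_abs w.re]
    gcongr
  have hpos : 0 < Complex.normSq (w + l * Complex.I) := by
    simp only [Complex.normSq_apply, Complex.add_re, Complex.add_im, Complex.mul_re,
      Complex.mul_im, Complex.ofReal_re, Complex.ofReal_im, Complex.I_re, Complex.I_im]
    nlinarith
  rw [Complex.div_re, ← add_div, le_div_iff₀ hpos]
  simp only [Complex.normSq_apply, Complex.add_re, Complex.add_im, Complex.mul_re,
      Complex.mul_im, Complex.ofReal_re, Complex.ofReal_im, Complex.I_re, Complex.I_im]
  nlinarith

lemma le_norm_add_mul_I {l : ℝ} {w : ℂ} (hw : 0 ≤ w.im) :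
    l ≤ ‖w + l * Complex.I‖ := by
  have h := Complex.abs_im_le_norm (w + l * Complex.I)
  simp only [Complex.add_im, Complex.mul_im, Complex.ofReal_re,
    Complex.ofReal_im, Complex.I_re, Complex.I_im, mul_one, mul_zero, add_zero] at h
  exact (by linarith : l ≤ w.im + l).trans ((le_abs_self _).trans h)

lemma differentiableAt_kolmogorov_cauchyTransform {l : ℝ} (hl : 0 < l) (hz : 0 < z.im) :
    DifferentiableAt ℂ
      (fun z => cauchyTransform ν z / (cauchyTransform ν z + l * Complex.I)) z := by
  have hd : DifferentiableAt ℂ (cauchyTransform ν) z := differentiableAt_cauchyTransform hz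
    (Eventually.of_forall fun s => im_le_norm_ofReal_sub s z)
  refine hd.div (hd.add_const _) ?_
  exact norm_pos_iff.1 (hl.trans_le (le_norm_add_mul_I (cauchyTransform_im_nonneg hz)))

lemma norm_integral_kolmogorov_cauchyTransform_le {x r l ε : ℝ} (hr : 0 < r) (hl : 0 < l)
    (hε : 0 < ε) (hν : ∀ᵐ s : ℝ ∂ν, |s - x| ≤ 2 * r) :
    ‖∫ t in (x - 4 * r)..(x + 4 * r), cauchyTransform ν (t + ε * Complex.I) /
      (cauchyTransform ν (t + ε * Complex.I) + l * Complex.I)‖ ≤ 8 * ν.real Set.univ / l := by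
  set f : ℂ → ℂ := fun z => cauchyTransform ν z / (cauchyTransform ν z + l * Complex.I) with hf
  have hM : ∀ z : ℂ, 0 < z.im → (4 * r ≤ |z.re - x| ∨ 4 * r ≤ z.im) →
      ‖f z‖ ≤ ν.real Set.univ / (2 * r) / l := by
    intro z hz h
    have h1 : ‖cauchyTransform ν z‖ ≤ ν.real Set.univ / (2 * r) := by
      refine norm_cauchyTransform_le (by positivity) ?_
      filter_upwards [hν] with s hs
      rcases h with h | h
      · refine le_trans ?_ (abs_sub_re_le_norm_ofReal_sub s z)
        have := abs_sub_abs_le_abs_sub (z.re - x) (s - x)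
        rw [abs_sub_comm s z.re]
        have h3 : z.re - x - (s - x) = z.re - s := by ring
        rw [h3] at this
        linarith
      · have := im_le_norm_ofReal_sub s z
        linarith
    rw [hf]
    simp only [norm_div]
    exact div_le_div₀ (by positivity) h1 hl (le_norm_add_mul_I (cauchyTransform_im_nonneg hz))
  have hrect := Complex.integral_boundary_rect_eq_zero_of_differentiableOn f
    ⟨x - 4 * r, ε⟩ ⟨x + 4 * r, ε + 4 * r⟩ (by
      intro z hz
      refine (differentiableAt_kolmogorov_cauchyTransform hl ?_).differentiableWithinAt
      have := hz.2
      simp only [Set.mem_preimage] at this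
      rw [Set.uIcc_of_le (by linarith)] at this
      exact hε.trans_le this.1)
  simp only at hrect
  have htop : ‖∫ t in (x - 4 * r)..(x + 4 * r), f (t + (ε + 4 * r : ℝ) * Complex.I)‖ ≤
      ν.real Set.univ / (2 * r) / l * |x + 4 * r - (x - 4 * r)| := by
    refine intervalIntegral.norm_integral_le_of_norm_le_const fun t _ => hM _ ?_ (Or.inr ?_) <;>
    simp <;> linarith
  have hright : ‖∫ y in ε..(ε + 4 * r), f ((x + 4 * r : ℝ) + y * Complex.I)‖ ≤
      ν.real Set.univ / (2 * r) / l * |ε + 4 * r - ε| := by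
    refine intervalIntegral.norm_integral_le_of_norm_le_const fun t ht => hM _ ?_ (Or.inl ?_)
    · rw [Set.uIoc_of_le (by linarith)] at ht
      simpa using hε.trans ht.1
    · simp [abs_of_pos hr]
  have hleft : ‖∫ y in ε..(ε + 4 * r), f ((x - 4 * r : ℝ) + y * Complex.I)‖ ≤
      ν.real Set.univ / (2 * r) / l * |ε + 4 * r - ε| := by
    refine intervalIntegral.norm_integral_le_of_norm_le_const fun t ht => hM _ ?_ (Or.inl ?_)
    · rw [Set.uIoc_of_le (by linarith)] at ht
      simpa using hε.trans ht.1
    · simp [abs_of_pos hr]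
  have e1 : |x + 4 * r - (x - 4 * r)| = 8 * r := by
    rw [abs_of_pos] <;> linarith
  have e2 : |ε + 4 * r - ε| = 4 * r := by
    rw [abs_of_pos] <;> linarith
  rw [e1] at htop
  rw [e2] at hright hleft
  set T := ∫ t in (x - 4 * r)..(x + 4 * r), f (t + (ε + 4 * r : ℝ) * Complex.I)
  set R := ∫ y in ε..(ε + 4 * r), f ((x + 4 * r : ℝ) + y * Complex.I)
  set L := ∫ y in ε..(ε + 4 * r), f ((x - 4 * r : ℝ) + y * Complex.I)
  have hB : (∫ t in (x - 4 * r)..(x + 4 * r), f (t + ε * Complex.I)) =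
      T - Complex.I • R + Complex.I • L := by
    linear_combination hrect
  change ‖∫ t in (x - 4 * r)..(x + 4 * r), f (t + ε * Complex.I)‖ ≤ _
  rw [hB]
  calc ‖T - Complex.I • R + Complex.I • L‖ ≤ ‖T‖ + ‖Complex.I • R‖ + ‖Complex.I • L‖ :=
        (norm_add_le _ _).trans (add_le_add_left (norm_sub_le _ _) _)
    _ = ‖T‖ + ‖R‖ + ‖L‖ := by simp
    _ ≤ ν.real Set.univ / (2 * r) / l * (8 * r) + ν.real Set.univ / (2 * r) / l * (4 * r) +
        ν.real Set.univ / (2 * r) / l * (4 * r) := by gcongr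
    _ = 8 * ν.real Set.univ / l := by field_simp; ring

/-- Weak type bound for the boundary values of the Cauchy transform of a finite measure. -/
theorem volume_le_of_le_abs_re_cauchyTransform {x r l : ℝ} (hr : 0 < r) (hl : 0 < l)
    (hν : ∀ᵐ s : ℝ ∂ν, |s - x| ≤ 2 * r) {S : Set ℝ}
    (hSr : ∀ t ∈ S, |t - x| ≤ r)
    (h : ∀ᵐ t : ℝ ∂(volume.restrict S), ∀ᶠ y : ℝ in 𝓝[>] 0,
      l ≤ |(cauchyTransform ν (t + y * Complex.I)).re|) :
    volume S ≤ ENNReal.ofReal (16 * ν.real Set.univ / l) := by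
  set f : ℂ → ℂ := fun z => cauchyTransform ν z / (cauchyTransform ν z + l * Complex.I) with hf
  set ε : ℕ → ℝ := fun n => 1 / ((n : ℝ) + 1) with hεdef
  have hε : ∀ n, 0 < ε n := fun n => by positivity
  have hεlim : Tendsto ε atTop (𝓝[>] 0) := tendsto_nhdsWithin_iff.2
    ⟨tendsto_one_div_add_atTop_nhds_zero_nat, Eventually.of_forall hε⟩
  have hline : ∀ n, Continuous fun t : ℝ => f (t + ε n * Complex.I) := by
    intro n
    refine continuous_iff_continuousAt.2 fun t => ?_
    have h1 : ContinuousAt f (t + ε n * Complex.I) :=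
      (differentiableAt_kolmogorov_cauchyTransform hl (by simpa using hε n)).continuousAt
    exact ContinuousAt.comp (f := fun t : ℝ => (t : ℂ) + ε n * Complex.I) h1 (by fun_prop)
  have hnonneg : ∀ n (t : ℝ), 0 ≤ (f (t + ε n * Complex.I)).re := fun n t =>
    re_div_add_mul_I_nonneg hl (cauchyTransform_im_nonneg (by simpa using hε n))
  have hSsub : S ⊆ Set.Ioc (x - 4 * r) (x + 4 * r) := by
    intro t ht
    have := abs_le.1 (hSr t ht)
    constructor <;> linarith
  have hInt : ∀ n, ∫⁻ t in S, ENNReal.ofReal (f (t + ε n * Complex.I)).re ≤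
      ENNReal.ofReal (8 * ν.real Set.univ / l) := by
    intro n
    have hle : x - 4 * r ≤ x + 4 * r := by linarith
    have hI : IntegrableOn (fun t : ℝ => f (t + ε n * Complex.I))
        (Set.Ioc (x - 4 * r) (x + 4 * r)) :=
      ((hline n).intervalIntegrable _ _).1
    calc ∫⁻ t in S, ENNReal.ofReal (f (t + ε n * Complex.I)).re
        ≤ ∫⁻ t in Set.Ioc (x - 4 * r) (x + 4 * r), ENNReal.ofReal (f (t + ε n * Complex.I)).re :=
          lintegral_mono_set hSsub
      _ = ENNReal.ofReal (∫ t in Set.Ioc (x - 4 * r) (x + 4 * r), (f (t + ε n * Complex.I)).re) :=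
          (ofReal_integral_eq_lintegral_ofReal hI.re (Eventually.of_forall (hnonneg n))).symm
      _ ≤ ENNReal.ofReal (8 * ν.real Set.univ / l) := by
          refine ENNReal.ofReal_le_ofReal ?_
          have h1 : ∫ t in Set.Ioc (x - 4 * r) (x + 4 * r), (f (t + ε n * Complex.I)).re =
              (∫ t in Set.Ioc (x - 4 * r) (x + 4 * r), f (t + ε n * Complex.I)).re :=
            integral_re hI
          rw [h1, ← intervalIntegral.integral_of_le hle]
          exact (Complex.re_le_norm _).trans
            (norm_integral_kolmogorov_cauchyTransform_le hr hl (hε n) hν)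
  have hhalf : ENNReal.ofReal (1 / 2) * volume S ≤ ENNReal.ofReal (8 * ν.real Set.univ / l) := by
    calc ENNReal.ofReal (1 / 2) * volume S = ∫⁻ _ in S, ENNReal.ofReal (1 / 2) := by simp
      _ ≤ ∫⁻ t in S, liminf (fun n => ENNReal.ofReal (f (t + ε n * Complex.I)).re) atTop := by
          refine lintegral_mono_ae ?_
          filter_upwards [h] with t ht
          refine le_liminf_of_le (by isBoundedDefault) ?_
          filter_upwards [hεlim.eventually ht] with n hn
          exact ENNReal.ofReal_le_ofReal (half_le_re_div_add_mul_I hl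
            (cauchyTransform_im_nonneg (by simpa using hε n)) hn)
      _ ≤ liminf (fun n => ∫⁻ t in S, ENNReal.ofReal (f (t + ε n * Complex.I)).re) atTop :=
          lintegral_liminf_le fun n =>
            (Complex.measurable_re.comp (hline n).measurable).ennreal_ofReal
      _ ≤ ENNReal.ofReal (8 * ν.real Set.univ / l) :=
          liminf_le_of_le (by isBoundedDefault) fun b hb => by
            obtain ⟨n, hn⟩ := hb.exists
            exact hn.trans (hInt n)
  calc volume S = ENNReal.ofReal 2 * (ENNReal.ofReal (1 / 2) * volume S) := by
        rw [← mul_assoc, ← ENNReal.ofReal_mul (by norm_num)]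
        norm_num
    _ ≤ ENNReal.ofReal 2 * ENNReal.ofReal (8 * ν.real Set.univ / l) := by gcongr
    _ = ENNReal.ofReal (16 * ν.real Set.univ / l) := by
        rw [← ENNReal.ofReal_mul (by norm_num)]
        congr 1
        ring

end CauchyTransform

lemma one_add_sq_ne_zero_complex (s : ℝ) : (s : ℂ) ^ 2 + 1 ≠ 0 := by
  have h : (0 : ℝ) < s ^ 2 + 1 := by positivity
  exact_mod_cast h.ne'

lemma norm_sq_add_one_complex (s : ℝ) : ‖(s : ℂ) ^ 2 + 1‖ = s ^ 2 + 1 := by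
  have h : (0 : ℝ) ≤ s ^ 2 + 1 := by positivity
  have h2 : (s : ℂ) ^ 2 + 1 = ((s ^ 2 + 1 : ℝ) : ℂ) := by push_cast; ring
  rw [h2, Complex.norm_of_nonneg h]

lemma norm_div_sq_add_one_le_one (s : ℝ) : ‖(s : ℂ) / ((s : ℂ) ^ 2 + 1)‖ ≤ 1 := by
  rw [norm_div, norm_sq_add_one_complex, Complex.norm_real, Real.norm_eq_abs,
    div_le_one (by positivity)]
  nlinarith [sq_abs s, sq_nonneg (|s| - 1), abs_nonneg s]

lemma measurable_herglotzKernel (z : ℂ) :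
    Measurable fun s : ℝ => (((s : ℂ) - z)⁻¹ - (s : ℂ) / ((s : ℂ) ^ 2 + 1)) := by
  fun_prop

/-- The weight dominating the Herglotz kernel at scale `r` around the point `x`. -/
noncomputable def kernelWeight (x r s : ℝ) : ℝ := (1 + |s|) / (s ^ 2 + 1) * (r / (|s - x| + r))

lemma kernelWeight_nonneg {x r s : ℝ} (hr : 0 < r) : 0 ≤ kernelWeight x r s := by
  unfold kernelWeight
  positivity

lemma measurable_kernelWeight (x r : ℝ) : Measurable (kernelWeight x r) := by
  unfold kernelWeight
  fun_prop

lemma kernelWeight_le {x r : ℝ} (hr : 0 < r) (hr1 : r ≤ 1) (s : ℝ) :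
    kernelWeight x r s ≤ (2 + |x|) * (s ^ 2 + 1)⁻¹ := by
  have h0 : 0 < |s - x| + r := by positivity
  have h1 : |s| ≤ |x| + |s - x| := by
    have := abs_add_le x (s - x)
    rwa [add_sub_cancel] at this
  have h2 : (1 + |s|) * (r / (|s - x| + r)) ≤ 2 + |x| := by
    rw [← mul_div_assoc, div_le_iff₀ h0]
    nlinarith [abs_nonneg (s - x), abs_nonneg x,
      mul_le_mul_of_nonneg_right hr1 (abs_nonneg (s - x)),
      mul_nonneg (abs_nonneg x) (abs_nonneg (s - x)), abs_nonneg s]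
  calc kernelWeight x r s = (1 + |s|) * (r / (|s - x| + r)) * (s ^ 2 + 1)⁻¹ := by
        unfold kernelWeight; ring
    _ ≤ _ := by gcongr

lemma mul_norm_herglotzKernel_le {x r K s : ℝ} {z : ℂ} (hr : 0 < r) (hK : 1 ≤ K)
    (hz : ‖z‖ ≤ K) (h : |s - x| + r ≤ 8 * ‖(s : ℂ) - z‖) :
    r * ‖((s : ℂ) - z)⁻¹ - (s : ℂ) / ((s : ℂ) ^ 2 + 1)‖ ≤ 8 * K * kernelWeight x r s := by
  have h0 : 0 < |s - x| + r := by positivity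
  have hpos : 0 < ‖(s : ℂ) - z‖ := by linarith
  have hne : (s : ℂ) - z ≠ 0 := norm_pos_iff.1 hpos
  have hid : ((s : ℂ) - z)⁻¹ - (s : ℂ) / ((s : ℂ) ^ 2 + 1) =
      (1 + s * z) / (((s : ℂ) ^ 2 + 1) * ((s : ℂ) - z)) := by
    have := one_add_sq_ne_zero_complex s
    field_simp
    ring
  have hnum : ‖1 + s * z‖ ≤ K * (1 + |s|) := by
    calc ‖1 + s * z‖ ≤ 1 + |s| * ‖z‖ := by
          refine (norm_add_le _ _).trans ?_
          simp
      _ ≤ K * (1 + |s|) := by nlinarith [abs_nonneg s]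
  have hinv : r / ‖(s : ℂ) - z‖ ≤ 8 * (r / (|s - x| + r)) := by
    rw [← mul_div_assoc, div_le_div_iff₀ hpos h0]
    nlinarith
  rw [hid, norm_div, norm_mul, norm_sq_add_one_complex]
  calc r * (‖1 + s * z‖ / ((s ^ 2 + 1) * ‖(s : ℂ) - z‖))
      = ‖1 + s * z‖ / (s ^ 2 + 1) * (r / ‖(s : ℂ) - z‖) := by field_simp
    _ ≤ K * (1 + |s|) / (s ^ 2 + 1) * (8 * (r / (|s - x| + r))) := by gcongr
    _ = 8 * K * kernelWeight x r s := by unfold kernelWeight; ring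

section HerglotzMeasure

variable {μ : Measure ℝ}

lemma measure_closedBall_lt_top_of_integrable
    (hμ : Integrable (fun t : ℝ => (t ^ 2 + 1)⁻¹) μ)
    (x R : ℝ) : μ (Metric.closedBall x R) < ⊤ := by
  have hsub : Metric.closedBall x R ⊆
      {t : ℝ | ((|x| + |R|) ^ 2 + 1)⁻¹ ≤ ‖(t ^ 2 + 1)⁻¹‖} := by
    intro t ht
    have h1 : |t - x| ≤ |R| := (by simpa [Real.dist_eq] using ht : |t - x| ≤ R).trans (le_abs_self R)
    have h2 : |t| ≤ |x| + |R| := by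
      have := abs_add_le x (t - x)
      rw [add_sub_cancel] at this
      linarith
    have h3 : t ^ 2 ≤ (|x| + |R|) ^ 2 := by
      rw [← sq_abs t]
      gcongr
    have h4 : (0 : ℝ) < t ^ 2 + 1 := by positivity
    simp only [Set.mem_ofPred_eq, norm_inv, Real.norm_eq_abs, abs_of_pos h4]
    gcongr
  exact (measure_mono hsub).trans_lt (hμ.measure_norm_ge_lt_top (by positivity))

lemma integrable_kernelWeight
    (hμ : Integrable (fun t : ℝ => (t ^ 2 + 1)⁻¹) μ)
    {x r : ℝ} (hr : 0 < r) (hr1 : r ≤ 1) :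
    Integrable (kernelWeight x r) μ := by
  refine (hμ.const_mul (2 + |x|)).mono' (measurable_kernelWeight x r).aestronglyMeasurable
    (Eventually.of_forall fun s => ?_)
  rw [Real.norm_of_nonneg (kernelWeight_nonneg hr)]
  exact kernelWeight_le hr hr1 s

lemma tendsto_integral_kernelWeight
    (hμ : Integrable (fun t : ℝ => (t ^ 2 + 1)⁻¹) μ)
    {x : ℝ} (hx : μ {x} = 0) :
    Tendsto (fun r => ∫ s, kernelWeight x r s ∂μ) (𝓝[>] 0) (𝓝 0) := by
  have h01 : ∀ᶠ r : ℝ in 𝓝[>] 0, r ∈ Set.Ioc (0 : ℝ) 1 := Ioc_mem_nhdsGT one_pos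
  have key := tendsto_integral_filter_of_dominated_convergence (μ := μ) (l := 𝓝[>] (0 : ℝ))
    (F := fun r => kernelWeight x r) (f := fun _ => (0 : ℝ))
    (fun t : ℝ => (2 + |x|) * (t ^ 2 + 1)⁻¹)
    (Eventually.of_forall fun r => (measurable_kernelWeight x r).aestronglyMeasurable) ?_
    (hμ.const_mul _) ?_
  · simpa using key
  · filter_upwards [h01] with r hr
    refine Eventually.of_forall fun s => ?_
    rw [Real.norm_of_nonneg (kernelWeight_nonneg hr.1)]
    exact kernelWeight_le hr.1 hr.2 s
  · have hne : ∀ᵐ s ∂μ, s ≠ x := by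
      rw [ae_iff]
      simpa using hx
    filter_upwards [hne] with s hs
    have hpos : 0 < |s - x| := abs_pos.2 (sub_ne_zero.2 hs)
    have hc : ContinuousAt (fun r => kernelWeight x r s) 0 := by
      unfold kernelWeight
      have : |s - x| + 0 ≠ 0 := by simpa using hpos.ne'
      fun_prop (disch := assumption)
    have := hc.tendsto.mono_left (nhdsWithin_le_nhds (s := Set.Ioi 0))
    simpa [kernelWeight] using this

lemma integrable_herglotzKernel
    (hμ : Integrable (fun t : ℝ => (t ^ 2 + 1)⁻¹) μ)
    {z : ℂ} (hz : 0 < z.im) :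
    Integrable (fun s : ℝ => (((s : ℂ) - z)⁻¹ - (s : ℂ) / ((s : ℂ) ^ 2 + 1))) μ := by
  set r := min z.im 1
  have hr : 0 < r := lt_min hz one_pos
  refine ((integrable_kernelWeight (x := z.re) hμ hr (min_le_right _ _)).const_mul
    (8 * (1 + ‖z‖) / r)).mono' (measurable_herglotzKernel z).aestronglyMeasurable
    (Eventually.of_forall fun s => ?_)
  have h := mul_norm_herglotzKernel_le (s := s) (x := z.re) hr (K := 1 + ‖z‖) (z := z)
    (by linarith [norm_nonneg z]) (by linarith) (by
      have h1 := im_le_norm_ofReal_sub s z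
      have h2 := abs_sub_re_le_norm_ofReal_sub s z
      have h3 : r ≤ z.im := min_le_left _ _
      linarith [norm_nonneg ((s : ℂ) - z)])
  rw [div_mul_eq_mul_div, le_div_iff₀ hr, mul_comm]
  exact h

lemma tendsto_mul_herglotzFn_of_measure_singleton_eq_zero
    (hμ : Integrable (fun t : ℝ => (t ^ 2 + 1)⁻¹) μ)
    {x : ℝ} (hx : μ {x} = 0) (a b : ℝ) :
    Tendsto (fun y : ℝ => (y : ℂ) * herglotzFn μ a b (x + y * Complex.I)) (𝓝[>] 0) (𝓝 0) := by
  have hpoly : Tendsto (fun y : ℝ => (y : ℂ) * (a + b * (x + y * Complex.I))) (𝓝[>] 0) (𝓝 0) := by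
    have : Continuous (fun y : ℝ => (y : ℂ) * (a + b * (x + y * Complex.I))) := by fun_prop
    simpa using (this.tendsto 0).mono_left (nhdsWithin_le_nhds (s := Set.Ioi 0))
  have hInt : Tendsto (fun y : ℝ => (y : ℂ) * ∫ s : ℝ, (((s : ℂ) - (x + y * Complex.I))⁻¹ -
      (s : ℂ) / ((s : ℂ) ^ 2 + 1)) ∂μ) (𝓝[>] 0) (𝓝 0) := by
    have hw := (tendsto_integral_kernelWeight hμ hx).const_mul (8 * (|x| + 1))
    rw [mul_zero] at hw
    refine squeeze_zero_norm' ?_ hw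
    filter_upwards [Ioc_mem_nhdsGT (one_pos (α := ℝ))] with y hy
    have him : ((x : ℂ) + y * Complex.I).im = y := by simp
    have hre : ((x : ℂ) + y * Complex.I).re = x := by simp
    have hK : ‖(x : ℂ) + y * Complex.I‖ ≤ |x| + 1 := by
      refine (norm_add_le _ _).trans ?_
      simpa [abs_of_pos hy.1] using hy.2
    rw [← integral_const_mul, ← integral_const_mul]
    refine norm_integral_le_of_norm_le
      ((integrable_kernelWeight hμ hy.1 hy.2).const_mul _) (Eventually.of_forall fun s => ?_)
    rw [norm_mul, Complex.norm_of_nonneg hy.1.le]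
    refine mul_norm_herglotzKernel_le hy.1 (by linarith [abs_nonneg x]) hK ?_
    have h1 := im_le_norm_ofReal_sub s ((x : ℂ) + y * Complex.I)
    have h2 := abs_sub_re_le_norm_ofReal_sub s ((x : ℂ) + y * Complex.I)
    rw [him] at h1
    rw [hre] at h2
    linarith [norm_nonneg ((s : ℂ) - (x + y * Complex.I))]
  have := hpoly.add hInt
  rw [add_zero] at this
  refine this.congr fun y => ?_
  rw [herglotzFn, ← mul_add]

lemma herglotzFn_eq_add_restrict_compl_singleton
    (hμ : Integrable (fun t : ℝ => (t ^ 2 + 1)⁻¹) μ)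
    (x a b : ℝ) {z : ℂ} (hz : 0 < z.im) :
    herglotzFn μ a b z = μ.real {x} * ((x : ℂ) - z)⁻¹ +
      herglotzFn (μ.restrict {x}ᶜ) (a - μ.real {x} * (x / (x ^ 2 + 1))) b z := by
  have hsplit := integral_add_compl (measurableSet_singleton x) (integrable_herglotzKernel hμ hz)
  rw [integral_singleton] at hsplit
  rw [herglotzFn, herglotzFn, ← hsplit, Complex.real_smul]
  push_cast
  ring

/-- Away from the annulus of radius `r`, a measure without an atom at `x` contributes only
`o(1 / r)` to its Herglotz function. -/
lemma exists_tendsto_mul_norm_herglotzFn_sub_cauchyTransform_le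
    (hμ : Integrable (fun t : ℝ => (t ^ 2 + 1)⁻¹) μ)
    {x : ℝ} (hx : μ {x} = 0)
    (a b : ℝ) : ∃ D : ℝ → ℝ, Tendsto D (𝓝[>] 0) (𝓝 0) ∧
      ∀ r ∈ Set.Ioc (0 : ℝ) 1, ∀ z : ℂ, 0 < z.im → z.im ≤ 1 → r / 2 < |z.re - x| →
        |z.re - x| ≤ r → r * ‖herglotzFn μ a b z -
          cauchyTransform (μ.restrict {s | r / 4 < |s - x| ∧ |s - x| ≤ 2 * r}) z‖ ≤ D r := by
  set K : ℝ := |x| + 2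
  have hK1 : 1 ≤ K := by linarith [abs_nonneg x]
  set M : ℝ := μ.real (Metric.closedBall x 2)
  refine ⟨fun r => r * (|a| + |b| * K + M) + 8 * K * ∫ s, kernelWeight x r s ∂μ, ?_, ?_⟩
  · have h1 : Tendsto (fun r : ℝ => r * (|a| + |b| * K + M)) (𝓝[>] 0) (𝓝 0) := by
      have : Continuous (fun r : ℝ => r * (|a| + |b| * K + M)) := by fun_prop
      simpa using (this.tendsto 0).mono_left (nhdsWithin_le_nhds (s := Set.Ioi 0))
    simpa using h1.add ((tendsto_integral_kernelWeight hμ hx).const_mul (8 * K))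
  · intro r hr z hz hz1 hzr hzr'
    obtain ⟨hr0, hr1⟩ := hr
    set N : Set ℝ := {s | r / 4 < |s - x| ∧ |s - x| ≤ 2 * r} with hN
    have hNm : MeasurableSet N :=
      (measurableSet_lt (f := fun _ => r / 4) (g := fun s => |s - x|)
        (by fun_prop) (by fun_prop)).inter
        (measurableSet_le (f := fun s => |s - x|) (g := fun _ => 2 * r)
          (by fun_prop) (by fun_prop))
    have hNsub : N ⊆ Metric.closedBall x 2 := by
      intro s hs
      rw [Metric.mem_closedBall, Real.dist_eq]
      linarith [hs.2]
    have hNfin : μ N < ⊤ :=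
      (measure_mono hNsub).trans_lt (measure_closedBall_lt_top_of_integrable hμ x 2)
    have : IsFiniteMeasure (μ.restrict N) := ⟨by simpa using hNfin⟩
    have hzK : ‖z‖ ≤ K := by
      have h1 := Complex.norm_le_abs_re_add_abs_im z
      rw [abs_of_pos hz] at h1
      have h2 := abs_add_le x (z.re - x)
      rw [add_sub_cancel] at h2
      linarith
    have hInt := integrable_herglotzKernel hμ hz
    have hinv : Integrable (fun s : ℝ => ((s : ℂ) - z)⁻¹) (μ.restrict N) :=
      integrable_inv_ofReal_sub hz (Eventually.of_forall fun s => im_le_norm_ofReal_sub s z)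
    have hconst : Integrable (fun s : ℝ => (s : ℂ) / ((s : ℂ) ^ 2 + 1)) (μ.restrict N) :=
      Integrable.of_bound (Measurable.aestronglyMeasurable (by fun_prop)) 1
        (Eventually.of_forall norm_div_sq_add_one_le_one)
    have hsplit := integral_add_compl hNm hInt
    rw [integral_sub hinv hconst] at hsplit
    have hid : herglotzFn μ a b z - cauchyTransform (μ.restrict N) z = a + b * z -
        (∫ s in N, (s : ℂ) / ((s : ℂ) ^ 2 + 1) ∂μ) +
        ∫ s in Nᶜ, (((s : ℂ) - z)⁻¹ - (s : ℂ) / ((s : ℂ) ^ 2 + 1)) ∂μ := by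
      rw [herglotzFn, ← hsplit, cauchyTransform]
      ring
    have hb1 : ‖∫ s in N, (s : ℂ) / ((s : ℂ) ^ 2 + 1) ∂μ‖ ≤ M := by
      have h1 := norm_setIntegral_le_of_norm_le_const (μ := μ) hNfin
        (fun s _ => norm_div_sq_add_one_le_one s)
      rw [one_mul] at h1
      exact h1.trans (measureReal_mono hNsub
        (measure_closedBall_lt_top_of_integrable hμ x 2).ne)
    have hb2 : r * ‖∫ s in Nᶜ, (((s : ℂ) - z)⁻¹ - (s : ℂ) / ((s : ℂ) ^ 2 + 1)) ∂μ‖ ≤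
        8 * K * ∫ s, kernelWeight x r s ∂μ := by
      have hw := integrable_kernelWeight (x := x) hμ hr0 hr1
      have h1 : ‖∫ s in Nᶜ, (r : ℂ) * (((s : ℂ) - z)⁻¹ - (s : ℂ) / ((s : ℂ) ^ 2 + 1)) ∂μ‖ ≤
          ∫ s in Nᶜ, 8 * K * kernelWeight x r s ∂μ := by
        refine norm_integral_le_of_norm_le (hw.const_mul _).integrableOn ?_
        filter_upwards [ae_restrict_mem hNm.compl] with s hs
        rw [norm_mul, Complex.norm_of_nonneg hr0.le]
        refine mul_norm_herglotzKernel_le hr0 hK1 hzK ?_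
        have h2 := abs_sub_re_le_norm_ofReal_sub s z
        simp only [hN, Set.mem_compl_iff, Set.mem_ofPred_eq, not_and_or, not_lt, not_le] at hs
        have h3 := abs_sub_abs_le_abs_sub (z.re - x) (s - x)
        have h4 := abs_sub_abs_le_abs_sub (s - x) (z.re - x)
        rw [show z.re - x - (s - x) = -(s - z.re) by ring, abs_neg] at h3
        rw [show s - x - (z.re - x) = s - z.re by ring] at h4
        rcases hs with hs | hs <;> linarith
      rw [integral_const_mul, norm_mul, Complex.norm_of_nonneg hr0.le, integral_const_mul] at h1
      refine h1.trans ?_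
      exact mul_le_mul_of_nonneg_left (setIntegral_le_integral hw
        (Eventually.of_forall fun s => kernelWeight_nonneg hr0)) (by positivity)
    rw [hid]
    have hab : ‖(a : ℂ) + b * z‖ ≤ |a| + |b| * K := by
      refine (norm_add_le _ _).trans ?_
      rw [norm_mul, Complex.norm_real, Complex.norm_real, Real.norm_eq_abs, Real.norm_eq_abs]
      gcongr
    have htri : ‖(a : ℂ) + b * z - (∫ s in N, (s : ℂ) / ((s : ℂ) ^ 2 + 1) ∂μ) +
        ∫ s in Nᶜ, (((s : ℂ) - z)⁻¹ - (s : ℂ) / ((s : ℂ) ^ 2 + 1)) ∂μ‖ ≤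
        (|a| + |b| * K) + M +
          ‖∫ s in Nᶜ, (((s : ℂ) - z)⁻¹ - (s : ℂ) / ((s : ℂ) ^ 2 + 1)) ∂μ‖ := by
      refine (norm_add_le _ _).trans ?_
      gcongr
      exact (norm_sub_le _ _).trans (add_le_add hab hb1)
    calc _ ≤ r * ((|a| + |b| * K) + M +
          ‖∫ s in Nᶜ, (((s : ℂ) - z)⁻¹ - (s : ℂ) / ((s : ℂ) ^ 2 + 1)) ∂μ‖) := by gcongr
      _ ≤ _ := by rw [mul_add]; exact add_le_add le_rfl hb2

end HerglotzMeasure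

section PointMass

variable {μ : Measure ℝ}

/-- Near a point mass of a reflectionless measure, `E` is thin: its part in a small ring is
controlled by the rest of the measure in a slightly larger ring. -/
lemma eventually_volume_ring_inter_le
    (hμ : Integrable (fun t : ℝ => (t ^ 2 + 1)⁻¹) μ)
    {x : ℝ} (hc : 0 < μ.real {x}) {E : Set ℝ} {a b : ℝ}
    (href : ∀ᵐ t : ℝ ∂(volume.restrict E),
      Tendsto (fun y : ℝ => (herglotzFn μ a b ((t : ℂ) + y * Complex.I)).re)
        (𝓝[>] (0 : ℝ)) (𝓝 0)) :
    ∀ᶠ r : ℝ in 𝓝[>] 0, volume ({t | r / 2 < |t - x| ∧ |t - x| ≤ r} ∩ E) ≤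
      ENNReal.ofReal (32 * r / μ.real {x}) *
        μ.restrict {x}ᶜ {s | r / 4 < |s - x| ∧ |s - x| ≤ 2 * r} := by
  set c := μ.real {x}
  have hμ' : Integrable (fun t : ℝ => (t ^ 2 + 1)⁻¹) (μ.restrict {x}ᶜ) := hμ.restrict
  have hx' : μ.restrict {x}ᶜ {x} = 0 := by
    rw [Measure.restrict_apply (measurableSet_singleton x)]
    simp
  obtain ⟨D, hD, hDle⟩ := exists_tendsto_mul_norm_herglotzFn_sub_cauchyTransform_le hμ' hx'
    (a - c * (x / (x ^ 2 + 1))) b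
  filter_upwards [hD.eventually (gt_mem_nhds (show (0 : ℝ) < c / 8 by positivity)),
    Ioc_mem_nhdsGT one_pos] with r hDr hr
  set N := {s | r / 4 < |s - x| ∧ |s - x| ≤ 2 * r} with hN
  have hr0 : 0 < r := hr.1
  have hNm : MeasurableSet N :=
    (measurableSet_lt (f := fun _ => r / 4) (g := fun s => |s - x|)
      (by fun_prop) (by fun_prop)).inter
      (measurableSet_le (f := fun s => |s - x|) (g := fun _ => 2 * r)
        (by fun_prop) (by fun_prop))
  have hNsub : N ⊆ Metric.closedBall x 2 := by
    intro s hs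
    rw [Metric.mem_closedBall, Real.dist_eq]
    linarith [hs.2, hr.2]
  have hNfin : μ.restrict {x}ᶜ N < ⊤ :=
    (measure_mono hNsub).trans_lt (measure_closedBall_lt_top_of_integrable hμ' x 2)
  have : IsFiniteMeasure ((μ.restrict {x}ᶜ).restrict N) := ⟨by simpa using hNfin⟩
  have hRm : MeasurableSet {t | r / 2 < |t - x| ∧ |t - x| ≤ r} :=
    (measurableSet_lt (f := fun _ => r / 2) (g := fun s => |s - x|)
      (by fun_prop) (by fun_prop)).inter
      (measurableSet_le (f := fun s => |s - x|) (g := fun _ => r)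
        (by fun_prop) (by fun_prop))
  have key := volume_le_of_le_abs_re_cauchyTransform (ν := (μ.restrict {x}ᶜ).restrict N)
    (x := x) (r := r) (l := c / (2 * r)) hr0 (by positivity)
    ((ae_restrict_mem hNm).mono fun s hs => hs.2)
    (S := {t | r / 2 < |t - x| ∧ |t - x| ≤ r} ∩ E) (fun t ht => ht.1.2) ?_
  · refine key.trans_eq ?_
    rw [measureReal_def, Measure.restrict_apply_univ]
    conv_rhs => rw [← ENNReal.ofReal_toReal hNfin.ne]
    rw [← ENNReal.ofReal_mul (by positivity)]
    congr 1
    field_simp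
    ring
  · rw [← Measure.restrict_restrict hRm]
    filter_upwards [ae_restrict_mem hRm, ae_restrict_of_ae href] with t ht href
    have htx : x - t ≠ 0 := by
      intro h
      have : t - x = 0 := by linarith
      have h2 := ht.1
      rw [this, abs_zero] at h2
      linarith
    have hcont : ContinuousAt
        (fun y : ℝ => |((c : ℂ) * ((x : ℂ) - (t + y * Complex.I))⁻¹).re|) 0 := by
      have : (x : ℂ) - (t + (0 : ℝ) * Complex.I) ≠ 0 := by
        simpa using (by exact_mod_cast htx : (x : ℂ) - t ≠ 0)
      refine ContinuousAt.abs (Complex.continuous_re.continuousAt.comp ?_)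
      fun_prop (disch := assumption)
    have hpole : ∀ᶠ y : ℝ in 𝓝[>] 0,
        3 * c / (4 * r) < |((c : ℂ) * ((x : ℂ) - (t + y * Complex.I))⁻¹).re| := by
      refine (hcont.tendsto.mono_left nhdsWithin_le_nhds).eventually (lt_mem_nhds ?_)
      have : (c : ℂ) * ((x : ℂ) - (t + (0 : ℝ) * Complex.I))⁻¹ = ((c * (x - t)⁻¹ : ℝ) : ℂ) := by
        push_cast
        simp
      rw [this, Complex.ofReal_re, abs_mul, abs_inv, abs_of_pos hc, abs_sub_comm]
      have h1 : c * r⁻¹ ≤ c * |t - x|⁻¹ := by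
        have : 0 < |t - x| := by linarith [ht.1]
        gcongr
        exact ht.2
      refine lt_of_lt_of_le ?_ h1
      rw [div_lt_iff₀ (by positivity)]
      field_simp
      norm_num
    have hH : ∀ᶠ y : ℝ in 𝓝[>] 0, |(herglotzFn μ a b ((t : ℂ) + y * Complex.I)).re| <
        c / (8 * r) := by
      have := href.abs
      rw [abs_zero] at this
      exact this.eventually (gt_mem_nhds (by positivity))
    filter_upwards [hpole, hH, Ioc_mem_nhdsGT (one_pos (α := ℝ))] with y hy1 hy2 hy3
    have hz : 0 < ((t : ℂ) + y * Complex.I).im := by simpa using hy3.1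
    have h3 := hDle r hr _ hz (by simpa using hy3.2) (by simpa using ht.1) (by simpa using ht.2)
    rw [herglotzFn_eq_add_restrict_compl_singleton hμ x a b hz, Complex.add_re] at hy2
    set P := ((c : ℂ) * ((x : ℂ) - (t + y * Complex.I))⁻¹).re
    set G := herglotzFn (μ.restrict {x}ᶜ) (a - c * (x / (x ^ 2 + 1))) b (t + y * Complex.I)
    set K := cauchyTransform ((μ.restrict {x}ᶜ).restrict N) (t + y * Complex.I)
    have h4 : |G.re - K.re| ≤ c / (8 * r) := by
      rw [← Complex.sub_re]
      refine (Complex.abs_re_le_norm _).trans ?_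
      rw [le_div_iff₀ (by positivity)]
      linarith
    have h5 : 3 * c / (4 * r) = c / (2 * r) + 2 * (c / (8 * r)) := by
      field_simp
      ring
    have h6 : |P| ≤ |P + G.re| + |G.re - K.re| + |K.re| := by
      have := abs_add_three (P + G.re) (-(G.re - K.re)) (-K.re)
      rwa [abs_neg, abs_neg, show P + G.re + -(G.re - K.re) + -K.re = P by ring] at this
    linarith

lemma eventually_lintegral_ring_inter_le
    (hμ : Integrable (fun t : ℝ => (t ^ 2 + 1)⁻¹) μ)
    {x : ℝ} (hc : 0 < μ.real {x}) {E : Set ℝ} {a b : ℝ}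
    (href : ∀ᵐ t : ℝ ∂(volume.restrict E),
      Tendsto (fun y : ℝ => (herglotzFn μ a b ((t : ℂ) + y * Complex.I)).re)
        (𝓝[>] (0 : ℝ)) (𝓝 0)) :
    ∀ᶠ r : ℝ in 𝓝[>] 0,
      ∫⁻ t in {t | r / 2 < |t - x| ∧ |t - x| ≤ r} ∩ E, ENNReal.ofReal |t - x|⁻¹ ≤
      ENNReal.ofReal (64 / μ.real {x}) *
        μ.restrict {x}ᶜ {s | r / 4 < |s - x| ∧ |s - x| ≤ 2 * r} := by
  filter_upwards [eventually_volume_ring_inter_le hμ hc href, self_mem_nhdsWithin] with r hr hr0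
  have hr0 : 0 < r := hr0
  calc ∫⁻ t in {t | r / 2 < |t - x| ∧ |t - x| ≤ r} ∩ E, ENNReal.ofReal |t - x|⁻¹
      ≤ ∫⁻ t in {t | r / 2 < |t - x| ∧ |t - x| ≤ r} ∩ E, ENNReal.ofReal (2 / r) := by
        refine setLIntegral_mono measurable_const fun t ht => ENNReal.ofReal_le_ofReal ?_
        rw [← one_div, div_le_div_iff₀ (by linarith [ht.1.1]) hr0]
        linarith [ht.1.1]
    _ ≤ ENNReal.ofReal (2 / r) * (ENNReal.ofReal (32 * r / μ.real {x}) *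
        μ.restrict {x}ᶜ {s | r / 4 < |s - x| ∧ |s - x| ≤ 2 * r}) := by
        rw [setLIntegral_const]
        gcongr
    _ = _ := by
        rw [← mul_assoc, ← ENNReal.ofReal_mul (by positivity)]
        congr 2
        field_simp
        norm_num

lemma tsum_measure_ring_le (ν : Measure ℝ) (x : ℝ) {ρ : ℝ} (hρ : 0 ≤ ρ) :
    ∑' n : ℕ, ν {s | ρ / 2 ^ (n + 1) < |s - x| ∧ |s - x| ≤ ρ / 2 ^ n} ≤
      ν (Metric.closedBall x ρ) := by
  have hanti : Antitone fun n : ℕ => ρ / 2 ^ n := by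
    intro m n h
    dsimp only
    gcongr
    norm_num
  refine (tsum_meas_le_meas_iUnion_of_disjoint ν (fun n => ?_) ?_).trans (measure_mono ?_)
  · exact (measurableSet_lt (f := fun _ => ρ / 2 ^ (n + 1)) (g := fun s => |s - x|)
      (by fun_prop) (by fun_prop)).inter
      (measurableSet_le (f := fun s => |s - x|) (g := fun _ => ρ / 2 ^ n)
        (by fun_prop) (by fun_prop))
  · intro m n hmn
    exact (hanti.pairwise_disjoint_on_Ioc_succ hmn).preimage fun s => |s - x|
  · refine Set.iUnion_subset fun n s hs => ?_
    rw [Metric.mem_closedBall, Real.dist_eq]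
    exact hs.2.trans (div_le_self hρ (one_le_pow₀ one_le_two))

lemma tsum_measure_wide_ring_le (ν : Measure ℝ) (x : ℝ) {r : ℝ} (hr : 0 ≤ r) :
    ∑' n : ℕ, ν {s | r / 2 ^ n / 4 < |s - x| ∧ |s - x| ≤ 2 * (r / 2 ^ n)} ≤
      3 * ν (Metric.closedBall x (2 * r)) := by
  set R : ℕ → Set ℝ := fun n => {s | 2 * r / 2 ^ (n + 1) < |s - x| ∧ |s - x| ≤ 2 * r / 2 ^ n}
  have hR : ∑' n, ν (R n) ≤ ν (Metric.closedBall x (2 * r)) :=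
    tsum_measure_ring_le ν x (by positivity)
  have hshift (k : ℕ) : ∑' n, ν (R (n + k)) ≤ ν (Metric.closedBall x (2 * r)) :=
    (ENNReal.tsum_comp_le_tsum_of_injective (add_left_injective k) fun n => ν (R n)).trans hR
  have hsub (n : ℕ) : {s | r / 2 ^ n / 4 < |s - x| ∧ |s - x| ≤ 2 * (r / 2 ^ n)} ⊆
      R n ∪ R (n + 1) ∪ R (n + 2) := by
    intro s hs
    simp only [Set.mem_ofPred_eq, Set.mem_union, R, pow_succ] at hs ⊢
    have e1 : 2 * r / (2 ^ n * 2) = r / 2 ^ n := by field_simp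
    have e2 : 2 * r / (2 ^ n * 2 * 2) = r / 2 ^ n / 2 := by field_simp
    have e3 : 2 * r / (2 ^ n * 2 * 2 * 2) = r / 2 ^ n / 4 := by field_simp; ring
    have e4 : 2 * r / 2 ^ n = 2 * (r / 2 ^ n) := by ring
    rw [e1, e2, e3, e4]
    grind
  calc ∑' n : ℕ, ν {s | r / 2 ^ n / 4 < |s - x| ∧ |s - x| ≤ 2 * (r / 2 ^ n)}
      ≤ ∑' n, (ν (R n) + ν (R (n + 1)) + ν (R (n + 2))) :=
        ENNReal.tsum_le_tsum fun n => (measure_mono (hsub n)).trans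
          ((measure_union_le _ _).trans (by gcongr; exact measure_union_le _ _))
    _ ≤ ν (Metric.closedBall x (2 * r)) + ν (Metric.closedBall x (2 * r)) +
        ν (Metric.closedBall x (2 * r)) := by
        rw [ENNReal.tsum_add, ENNReal.tsum_add]
        exact add_le_add (add_le_add hR (hshift 1)) (hshift 2)
    _ = _ := by ring

/-- A reflectionless measure can only charge `x` if `E` is thin at `x`. -/
theorem lintegral_lt_top_of_measure_singleton_pos
    (hμ : Integrable (fun t : ℝ => (t ^ 2 + 1)⁻¹) μ)
    {x : ℝ} (hc : 0 < μ.real {x}) {E : Set ℝ}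
    {a b : ℝ} (href : ∀ᵐ t : ℝ ∂(volume.restrict E),
      Tendsto (fun y : ℝ => (herglotzFn μ a b ((t : ℂ) + y * Complex.I)).re)
        (𝓝[>] (0 : ℝ)) (𝓝 0)) :
    ∫⁻ t in Set.Ioo (x - 1) (x + 1) ∩ E, ENNReal.ofReal |t - x|⁻¹ < ⊤ := by
  obtain ⟨r, hr0, hr⟩ := mem_nhdsGT_iff_exists_Ioc_subset.1
    (eventually_lintegral_ring_inter_le hμ hc href)
  have hr0 : 0 < r := hr0
  set A : ℕ → Set ℝ := fun n => {t | r / 2 ^ n / 2 < |t - x| ∧ |t - x| ≤ r / 2 ^ n}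
  have hcover : Set.Ioo (x - 1) (x + 1) ∩ E ⊆
      {x} ∪ (Set.Ioo (x - 1) (x + 1) ∩ {t | r < |t - x|}) ∪ ⋃ n, A n ∩ E := by
    rintro t ⟨ht, htE⟩
    rcases eq_or_ne t x with rfl | htx
    · exact Or.inl (Or.inl rfl)
    rcases lt_or_ge r |t - x| with h | h
    · exact Or.inl (Or.inr ⟨ht, h⟩)
    have hpos : 0 < |t - x| := abs_pos.2 (sub_ne_zero.2 htx)
    obtain ⟨n, h1, h2⟩ := exists_nat_pow_near_of_lt_one (x := |t - x| / r) (y := 1 / 2)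
      (by positivity) ((div_le_one hr0).2 h) (by norm_num) (by norm_num)
    refine Or.inr (Set.mem_iUnion.2 ⟨n, ⟨?_, ?_⟩, htE⟩)
    · rw [lt_div_iff₀ hr0] at h1
      refine lt_of_eq_of_lt ?_ h1
      rw [one_div, inv_pow, pow_succ]
      field_simp
    · rw [div_le_iff₀ hr0] at h2
      refine h2.trans_eq ?_
      rw [one_div, inv_pow]
      field_simp
  have hfar : ∫⁻ t in Set.Ioo (x - 1) (x + 1) ∩ {t | r < |t - x|}, ENNReal.ofReal |t - x|⁻¹ <
      ⊤ := by
    calc ∫⁻ t in Set.Ioo (x - 1) (x + 1) ∩ {t | r < |t - x|}, ENNReal.ofReal |t - x|⁻¹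
        ≤ ∫⁻ t in Set.Ioo (x - 1) (x + 1) ∩ {t | r < |t - x|}, ENNReal.ofReal r⁻¹ := by
          refine setLIntegral_mono measurable_const fun t ht => ENNReal.ofReal_le_ofReal ?_
          have : r < |t - x| := ht.2
          gcongr
      _ < ⊤ := by
          rw [setLIntegral_const]
          refine ENNReal.mul_lt_top ENNReal.ofReal_lt_top
            ((measure_mono Set.inter_subset_left).trans_lt ?_)
          rw [Real.volume_Ioo]
          exact ENNReal.ofReal_lt_top
  have hnear : ∫⁻ t in ⋃ n, A n ∩ E, ENNReal.ofReal |t - x|⁻¹ < ⊤ := by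
    calc ∫⁻ t in ⋃ n, A n ∩ E, ENNReal.ofReal |t - x|⁻¹
        ≤ ∑' n, ∫⁻ t in A n ∩ E, ENNReal.ofReal |t - x|⁻¹ := lintegral_iUnion_le _ _
      _ ≤ ∑' n, ENNReal.ofReal (64 / μ.real {x}) * μ.restrict {x}ᶜ
            {s | r / 2 ^ n / 4 < |s - x| ∧ |s - x| ≤ 2 * (r / 2 ^ n)} :=
          ENNReal.tsum_le_tsum fun n =>
            hr ⟨by positivity, div_le_self hr0.le (one_le_pow₀ one_le_two)⟩
      _ ≤ ENNReal.ofReal (64 / μ.real {x}) *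
            (3 * μ.restrict {x}ᶜ (Metric.closedBall x (2 * r))) := by
          rw [ENNReal.tsum_mul_left]
          gcongr
          exact tsum_measure_wide_ring_le _ x hr0.le
      _ < ⊤ := ENNReal.mul_lt_top ENNReal.ofReal_lt_top (ENNReal.mul_lt_top (by norm_num)
          (measure_closedBall_lt_top_of_integrable hμ.restrict _ _))
  refine (lintegral_mono_set hcover).trans_lt ((lintegral_union_le _ _ _).trans_lt
    (ENNReal.add_lt_top.2 ⟨(lintegral_union_le _ _ _).trans_lt
      (ENNReal.add_lt_top.2 ⟨?_, hfar⟩), hnear⟩))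
  rw [setLIntegral_measure_zero _ _ (measure_singleton x)]
  exact ENNReal.zero_lt_top

end PointMass

/-- **Schwarz integral formula** on the unit circle. -/
lemma circleAverage_herglotzRieszKernel_mul_re {f : ℂ → ℂ}
    (hf : DiffContOnCl ℂ f (Metric.ball 0 1)) {w : ℂ} (hw : w ∈ Metric.ball (0 : ℂ) 1) :
    Real.circleAverage (fun ζ => (ζ + w) / (ζ - w) * ((f ζ).re : ℂ)) 0 1 =
      f w - (f 0).im * Complex.I := by
  have h1 : Real.circleAverage (fun z => ((z - 0) / (z - w)) • f z) 0 1 = f w :=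
    DiffContOnCl.circleAverage_smul_div (R := 1) (by simpa using hf) (by simpa using hw)
  have h2 : Real.circleAverage f 0 1 = f 0 :=
    DiffContOnCl.circleAverage (by simpa using hf)
  have h3 := hf.circleAverage_re_herglotzRieszKernel_smul hw
  have hfc : ContinuousOn f (Metric.sphere 0 1) := hf.2.mono <|
    Metric.sphere_subset_closedBall.trans_eq (closure_ball 0 one_ne_zero).symm
  have hne : ∀ z ∈ Metric.sphere (0 : ℂ) 1, z - w ≠ 0 := by
    intro z hz h
    rw [sub_eq_zero.1 h] at hz
    exact absurd (mem_sphere_zero_iff_norm.1 hz) (mem_ball_zero_iff.1 hw).ne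
  have hkc : ContinuousOn (fun ζ : ℂ => (ζ + w) / (ζ - w)) (Metric.sphere 0 1) := by
    fun_prop (disch := assumption)
  have hi1 : CircleIntegrable (fun z => ((z - 0) / (z - w)) • f z) 0 1 := by
    refine ContinuousOn.circleIntegrable zero_le_one ?_
    fun_prop (disch := assumption)
  have hi2 : CircleIntegrable f 0 1 := hfc.circleIntegrable zero_le_one
  have hkf : CircleIntegrable (fun ζ => (ζ + w) / (ζ - w) * f ζ) 0 1 :=
    (hkc.mul hfc).circleIntegrable zero_le_one
  have hckf : CircleIntegrable (fun ζ => (starRingEnd ℂ) ((ζ + w) / (ζ - w)) * f ζ) 0 1 :=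
    ((Complex.continuous_conj.comp_continuousOn hkc).mul hfc).circleIntegrable zero_le_one
  have hkcf : CircleIntegrable (fun ζ => (ζ + w) / (ζ - w) * (starRingEnd ℂ) (f ζ)) 0 1 :=
    (hkc.mul (Complex.continuous_conj.comp_continuousOn hfc)).circleIntegrable zero_le_one
  have h4 : Real.circleAverage (fun ζ => (ζ + w) / (ζ - w) * f ζ) 0 1 = 2 * f w - f 0 := by
    have : Real.circleAverage (fun z => (2 : ℂ) • (((z - 0) / (z - w)) • f z) - f z) 0 1 =
        2 * f w - f 0 := by
      have hi : CircleIntegrable (fun z => (2 : ℂ) • (((z - 0) / (z - w)) • f z)) 0 1 :=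
        hi1.const_fun_smul
      rw [Real.circleAverage_fun_sub hi hi2,
        Real.circleAverage_fun_smul, h1, h2]
      simp
    rw [← this]
    refine Real.circleAverage_congr_sphere fun z hz => ?_
    rw [abs_one] at hz
    have := hne z hz
    simp only [sub_zero, smul_eq_mul]
    field_simp
    ring
  have h5 : Real.circleAverage (fun ζ => (starRingEnd ℂ) ((ζ + w) / (ζ - w)) * f ζ) 0 1 =
      f 0 := by
    have : Real.circleAverage (fun ζ => (2 : ℂ) • ((((ζ + w) / (ζ - w)).re : ℂ) * f ζ) -
        (ζ + w) / (ζ - w) * f ζ) 0 1 = 2 * f w - (2 * f w - f 0) := by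
      have hi : CircleIntegrable (fun ζ => (((ζ + w) / (ζ - w)).re : ℂ) * f ζ) 0 1 :=
        ((Complex.continuous_ofReal.comp_continuousOn
          (Complex.continuous_re.comp_continuousOn hkc)).mul hfc).circleIntegrable zero_le_one
      have hi' : CircleIntegrable
          (fun ζ => (2 : ℂ) • ((((ζ + w) / (ζ - w)).re : ℂ) * f ζ)) 0 1 := hi.const_fun_smul
      rw [Real.circleAverage_fun_sub hi' hkf,
        Real.circleAverage_fun_smul, h4]
      congr 1
      rw [smul_eq_mul, ← h3]
      congr 2
      ext ζ
      simp [herglotzRieszKernel_def]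
    rw [sub_sub_cancel] at this
    rw [← this]
    congr 1
    ext ζ
    set k := (ζ + w) / (ζ - w)
    have : (starRingEnd ℂ) k = 2 * (k.re : ℂ) - k := by
      apply Complex.ext
      · simp; ring
      · simp
    rw [this, smul_eq_mul]
    ring
  have h6 : Real.circleAverage (fun ζ => (ζ + w) / (ζ - w) * (starRingEnd ℂ) (f ζ)) 0 1 =
      (starRingEnd ℂ) (f 0) := by
    have := Complex.conjCLE.toContinuousLinearMap.circleAverage_comp_comm hckf
    rw [h5] at this
    rw [← Complex.conjCLE_apply]
    refine Eq.trans ?_ this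
    congr 1
    ext ζ
    simp
  have h7 : (fun ζ => (ζ + w) / (ζ - w) * ((f ζ).re : ℂ)) = fun ζ => (2⁻¹ : ℝ) •
      ((ζ + w) / (ζ - w) * f ζ + (ζ + w) / (ζ - w) * (starRingEnd ℂ) (f ζ)) := by
    ext ζ
    rw [Complex.re_eq_add_conj, Complex.real_smul]
    push_cast
    ring
  rw [h7, Real.circleAverage_fun_smul, Real.circleAverage_fun_add hkf hkcf, h4, h6,
    Complex.real_smul]
  apply Complex.ext
  · simp
  · simp; ring

/-- A continuous nonnegative density on the unit circle gives a finite measure representing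
circle averages against that density. -/
lemma exists_measure_sphere_integral_eq_circleAverage {g : ℂ → ℝ}
    (hg : ContinuousOn g (Metric.sphere 0 1)) (hg0 : ∀ ζ ∈ Metric.sphere (0 : ℂ) 1, 0 ≤ g ζ) :
    ∃ σ : FiniteMeasure (Metric.sphere (0 : ℂ) 1),
      ∀ k : ℂ → ℂ, ContinuousOn k (Metric.sphere 0 1) →
        ∫ ζ : Metric.sphere (0 : ℂ) 1, k ζ ∂(σ : Measure (Metric.sphere (0 : ℂ) 1)) =
          Real.circleAverage (fun ζ => k ζ * (g ζ : ℂ)) 0 1 := by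
  let e : ℝ → Metric.sphere (0 : ℂ) 1 := fun θ => ⟨circleMap 0 1 θ, by simp⟩
  have he : Continuous e := by fun_prop
  have hge : Continuous fun θ => g (e θ) :=
    hg.comp_continuous (by fun_prop) fun θ => (e θ).2
  let m : Measure ℝ := (volume.restrict (Set.Ioc 0 (2 * Real.pi))).withDensity
    fun θ => ENNReal.ofReal ((2 * Real.pi)⁻¹ * g (e θ))
  have hdm : Measurable fun θ => ENNReal.ofReal ((2 * Real.pi)⁻¹ * g (e θ)) :=
    (continuous_const.mul hge).measurable.ennreal_ofReal
  have hdi : Integrable (fun θ => (2 * Real.pi)⁻¹ * g (e θ))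
      (volume.restrict (Set.Ioc 0 (2 * Real.pi))) :=
    (continuous_const.mul hge).integrableOn_Ioc
  have : IsFiniteMeasure m := isFiniteMeasure_withDensity_ofReal hdi.2
  refine ⟨⟨m.map e, inferInstance⟩, fun k hk => ?_⟩
  have hke : Continuous fun ζ : Metric.sphere (0 : ℂ) 1 => k ζ :=
    hk.comp_continuous (by fun_prop) fun ζ => ζ.2
  change ∫ ζ, k ζ ∂(m.map e) = _
  rw [integral_map he.measurable.aemeasurable hke.aestronglyMeasurable,
    integral_withDensity_eq_integral_toReal_smul hdm (Eventually.of_forall fun _ =>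
      ENNReal.ofReal_lt_top), Real.circleAverage_def,
    intervalIntegral.integral_of_le Real.two_pi_pos.le, ← integral_smul]
  refine integral_congr_ae (Eventually.of_forall fun θ => ?_)
  have h0 : 0 ≤ (2 * Real.pi)⁻¹ * g (e θ) := by
    have := hg0 _ (e θ).2
    positivity
  simp only [ENNReal.toReal_ofReal h0, e, Complex.real_smul]
  push_cast
  ring

/-- **Herglotz representation theorem** for the unit disc. -/
theorem exists_finiteMeasure_sphere_eq_integral {f : ℂ → ℂ}
    (hf : DifferentiableOn ℂ f (Metric.ball 0 1))
    (hre : ∀ w ∈ Metric.ball (0 : ℂ) 1, 0 ≤ (f w).re) :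
    ∃ σ : Measure (Metric.sphere (0 : ℂ) 1), IsFiniteMeasure σ ∧ ∀ w ∈ Metric.ball (0 : ℂ) 1,
      f w = (f 0).im * Complex.I + ∫ ζ : Metric.sphere (0 : ℂ) 1, ((ζ : ℂ) + w) / (ζ - w) ∂σ := by
  let r : ℕ → ℝ := fun n => 1 - 1 / ((n : ℝ) + 1)
  have hr (n : ℕ) : 0 ≤ r n ∧ r n < 1 := by
    have h1 : (0 : ℝ) < (n : ℝ) + 1 := by positivity
    have h2 : 1 / ((n : ℝ) + 1) ≤ 1 := by
      rw [div_le_one h1]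
      linarith [(Nat.cast_nonneg n : (0 : ℝ) ≤ n)]
    exact ⟨by linarith, by linarith [one_div_pos.2 h1]⟩
  have hrlim : Tendsto r atTop (𝓝 1) := by
    simpa [r] using (tendsto_const_nhds (x := (1 : ℝ))).sub
      (tendsto_one_div_add_atTop_nhds_zero_nat (𝕜 := ℝ))
  have hball (n : ℕ) {w : ℂ} (hw : w ∈ Metric.closedBall (0 : ℂ) 1) :
      (r n : ℂ) * w ∈ Metric.ball (0 : ℂ) 1 := by
    rw [mem_closedBall_zero_iff] at hw
    rw [mem_ball_zero_iff, norm_mul, Complex.norm_real, Real.norm_of_nonneg (hr n).1]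
    nlinarith [hr n, norm_nonneg w]
  have hfn (n : ℕ) : DiffContOnCl ℂ (fun w => f (r n * w)) (Metric.ball 0 1) := by
    refine DifferentiableOn.diffContOnCl ?_
    rw [closure_ball _ one_ne_zero]
    exact hf.comp (by fun_prop) fun w hw => hball n hw
  have hex (n : ℕ) := exists_measure_sphere_integral_eq_circleAverage
    (g := fun ζ => (f (r n * ζ)).re)
    (Complex.continuous_re.comp_continuousOn ((hfn n).2.mono
      (Metric.sphere_subset_closedBall.trans_eq (closure_ball 0 one_ne_zero).symm)))
    (fun ζ hζ => hre _ (hball n (Metric.sphere_subset_closedBall hζ)))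
  choose σ hσ using hex
  have hform (n : ℕ) {w : ℂ} (hw : w ∈ Metric.ball (0 : ℂ) 1) :
      ∫ ζ : Metric.sphere (0 : ℂ) 1, ((ζ : ℂ) + w) / (ζ - w)
        ∂(σ n : Measure (Metric.sphere (0 : ℂ) 1)) = f (r n * w) - (f 0).im * Complex.I := by
    have h1 := circleAverage_herglotzRieszKernel_mul_re (hfn n) hw
    rw [mul_zero] at h1
    rw [← h1, ← hσ n fun ζ => (ζ + w) / (ζ - w)]
    have hne : ∀ z ∈ Metric.sphere (0 : ℂ) 1, z - w ≠ 0 := by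
      intro z hz h
      rw [sub_eq_zero.1 h] at hz
      exact absurd (mem_sphere_zero_iff_norm.1 hz) (mem_ball_zero_iff.1 hw).ne
    fun_prop (disch := assumption)
  have hmass (n : ℕ) : (σ n).mass ≤ (f 0).re.toNNReal := by
    have h1 := hform n (Metric.mem_ball_self (x := (0 : ℂ)) one_pos)
    have h2 (ζ : Metric.sphere (0 : ℂ) 1) : ((ζ : ℂ) + 0) / (ζ - 0) = 1 := by
      have : (ζ : ℂ) ≠ 0 := ne_zero_of_mem_unit_sphere ζ
      rw [add_zero, sub_zero, div_self this]
    simp only [h2, integral_const, mul_zero] at h1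
    have h3 := congrArg Complex.re h1
    simp at h3
    rw [← NNReal.coe_le_coe, Real.coe_toNNReal _ (hre 0 (Metric.mem_ball_self one_pos)), ← h3]
  obtain ⟨ν, -, hν⟩ := (isCompact_setOfPred_finiteMeasure_le_of_compactSpace
    (Metric.sphere (0 : ℂ) 1) (f 0).re.toNNReal).ultrafilter_le_nhds'
    ((hyperfilter ℕ).map σ) (Ultrafilter.mem_map.2 (Eventually.of_forall hmass))
  have hlim : Tendsto σ (hyperfilter ℕ) (𝓝 ν) := hν
  refine ⟨ν, inferInstance, fun w hw => ?_⟩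
  have hcont : Continuous fun ζ : Metric.sphere (0 : ℂ) 1 => ((ζ : ℂ) + w) / (ζ - w) := by
    have hne : ∀ z : Metric.sphere (0 : ℂ) 1, (z : ℂ) - w ≠ 0 := by
      intro z h
      have hz := z.2
      rw [sub_eq_zero.1 h] at hz
      exact absurd (mem_sphere_zero_iff_norm.1 hz) (mem_ball_zero_iff.1 hw).ne
    fun_prop (disch := assumption)
  have h1 := (FiniteMeasure.tendsto_iff_forall_integral_rclike_tendsto ℂ).1 hlim
    (BoundedContinuousFunction.mkOfCompact ⟨_, hcont⟩)
  simp only [BoundedContinuousFunction.mkOfCompact_apply, ContinuousMap.coe_mk,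
    hform _ hw] at h1
  have h2 : Tendsto (fun n => f (r n * w) - (f 0).im * Complex.I) (hyperfilter ℕ)
      (𝓝 (f w - (f 0).im * Complex.I)) := by
    have h3 : Tendsto (fun n => (r n : ℂ) * w) atTop (𝓝 w) := by
      simpa using ((Complex.continuous_ofReal.tendsto 1).comp hrlim).mul_const w
    have h4 := (hf.differentiableAt (Metric.isOpen_ball.mem_nhds hw)).continuousAt.tendsto.comp h3
    exact (h4.sub_const _).mono_left Nat.hyperfilter_le_atTop
  rw [← tendsto_nhds_unique h2 h1]
  ring

section HalfPlane

open Complex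

lemma add_I_ne_zero_of_im_nonneg {z : ℂ} (hz : 0 ≤ z.im) : z + I ≠ 0 := by
  intro h
  have := congrArg Complex.im h
  simp at this
  linarith

lemma cayley_mem_ball {z : ℂ} (hz : 0 < z.im) : (z - I) / (z + I) ∈ Metric.ball (0 : ℂ) 1 := by
  have h0 := add_I_ne_zero_of_im_nonneg hz.le
  rw [mem_ball_zero_iff, norm_div, div_lt_one (norm_pos_iff.2 h0)]
  refine lt_of_pow_lt_pow_left₀ 2 (norm_nonneg _) ?_
  rw [← normSq_eq_norm_sq, ← normSq_eq_norm_sq, normSq_apply, normSq_apply]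
  simp
  nlinarith

lemma inverseCayley_im_pos {w : ℂ} (hw : w ∈ Metric.ball (0 : ℂ) 1) :
    0 < (I * (1 + w) / (1 - w)).im := by
  have hn : normSq w < 1 := by
    rw [normSq_eq_norm_sq]
    have := mem_ball_zero_iff.1 hw
    nlinarith [norm_nonneg w]
  have h0 : 1 - w ≠ 0 := by
    intro h
    rw [← sub_eq_zero.1 h] at hn
    simp at hn
  rw [div_im, ← sub_div]
  refine div_pos ?_ (normSq_pos.2 h0)
  rw [normSq_apply] at hn
  simp
  nlinarith

lemma inverseCayley_cayley {z : ℂ} (hz : 0 < z.im) :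
    I * (1 + (z - I) / (z + I)) / (1 - (z - I) / (z + I)) = z := by
  have h0 := add_I_ne_zero_of_im_nonneg hz.le
  have h1 : 1 - (z - I) / (z + I) = 2 * I / (z + I) := by
    field_simp
    ring
  rw [h1]
  field_simp [I_ne_zero]
  ring

lemma ofReal_re_inverseCayley {ζ : ℂ} (hζ : ‖ζ‖ = 1) (h1 : ζ ≠ 1) :
    ((I * (1 + ζ) / (1 - ζ)).re : ℂ) = I * (1 + ζ) / (1 - ζ) := by
  rw [← conj_eq_iff_re]
  have h0 : ζ ≠ 0 := by
    rintro rfl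
    simp at hζ
  have h2 : 1 - ζ ≠ 0 := sub_ne_zero.2 h1.symm
  have h3 : 1 - ζ⁻¹ = -(1 - ζ) / ζ := by
    field_simp
    ring
  rw [map_div₀, map_mul, map_add, map_sub, map_one, conj_I, ← inv_eq_conj hζ, h3]
  field_simp
  ring

lemma herglotzKernel_eq {ζ z : ℂ} (hz : 0 < z.im) (h1 : ζ ≠ 1) {t : ℝ}
    (ht : (t : ℂ) = I * (1 + ζ) / (1 - ζ)) :
    I * ((ζ + (z - I) / (z + I)) / (ζ - (z - I) / (z + I))) = (1 + t * z) / (t - z) := by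
  have h0 := add_I_ne_zero_of_im_nonneg hz.le
  have h2 : (t : ℂ) + I ≠ 0 := add_I_ne_zero_of_im_nonneg (by simp)
  have h3 : 1 - ζ ≠ 0 := sub_ne_zero.2 h1.symm
  have hζ : ζ = (t - I) / (t + I) := by
    rw [eq_div_iff h2, ht]
    field_simp
    ring
  have htz : (t : ℂ) - z ≠ 0 := by
    intro h
    rw [← sub_eq_zero.1 h] at hz
    simp at hz
  have h4 : ζ + (z - I) / (z + I) = 2 * (1 + t * z) / ((t + I) * (z + I)) := by
    rw [hζ]
    field_simp
    linear_combination (-2) * I_sq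
  have h5 : ζ - (z - I) / (z + I) = 2 * I * (t - z) / ((t + I) * (z + I)) := by
    rw [hζ]
    field_simp
    ring
  rw [h4, h5]
  field_simp

/-- **Herglotz representation theorem** for the upper half plane. -/
theorem exists_eq_herglotzFn {F : ℂ → ℂ} (hF : DifferentiableOn ℂ F {z | 0 < z.im})
    (him : ∀ z : ℂ, 0 < z.im → 0 ≤ (F z).im) :
    ∃ (μ : Measure ℝ) (a b : ℝ), 0 ≤ b ∧ Integrable (fun t : ℝ => (t ^ 2 + 1)⁻¹) μ ∧
      ∀ z : ℂ, 0 < z.im → F z = herglotzFn μ a b z := by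
  let f : ℂ → ℂ := fun w => -I * F (I * (1 + w) / (1 - w))
  have hf : DifferentiableOn ℂ f (Metric.ball 0 1) := by
    refine DifferentiableOn.const_mul (hF.comp (fun w hw => ?_) fun w hw =>
      inverseCayley_im_pos hw) _
    have h0 : 1 - w ≠ 0 := by
      intro h
      rw [← sub_eq_zero.1 h] at hw
      simp at hw
    refine DifferentiableAt.differentiableWithinAt ?_
    fun_prop (disch := assumption)
  obtain ⟨σ, hσ, hrep⟩ := exists_finiteMeasure_sphere_eq_integral hf fun w hw => by
    simpa [f] using him _ (inverseCayley_im_pos hw)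
  let p : Metric.sphere (0 : ℂ) 1 := ⟨1, by simp⟩
  let T : Metric.sphere (0 : ℂ) 1 → ℝ := fun ζ => (I * (1 + (ζ : ℂ)) / (1 - ζ)).re
  have hT : Measurable T := by
    refine measurable_re.comp ?_
    fun_prop
  let ρ : Measure ℝ := (σ.restrict {p}ᶜ).map T
  have hdm : Measurable fun t : ℝ => ENNReal.ofReal (t ^ 2 + 1) := by fun_prop
  let μ : Measure ℝ := ρ.withDensity fun t => ENNReal.ofReal (t ^ 2 + 1)
  refine ⟨μ, -(f 0).im, σ.real {p}, measureReal_nonneg, ?_, fun z hz => ?_⟩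
  · rw [integrable_withDensity_iff_integrable_smul' hdm (Eventually.of_forall fun _ =>
      ENNReal.ofReal_lt_top)]
    refine (integrable_const (1 : ℝ)).congr (Eventually.of_forall fun t => ?_)
    have : 0 < t ^ 2 + 1 := by positivity
    simp only [ENNReal.toReal_ofReal this.le, smul_eq_mul]
    rw [mul_inv_cancel₀ this.ne']
  · set w := (z - I) / (z + I) with hw
    have hwb : w ∈ Metric.ball (0 : ℂ) 1 := cayley_mem_ball hz
    have hFz : F z = I * f w := by
      simp only [f, hw, inverseCayley_cayley hz]
      rw [← mul_assoc]
      simp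
    have hInt : Integrable (fun ζ : Metric.sphere (0 : ℂ) 1 => ((ζ : ℂ) + w) / (ζ - w)) σ := by
      have hne : ∀ z : Metric.sphere (0 : ℂ) 1, (z : ℂ) - w ≠ 0 := by
        intro z h
        have hz := z.2
        rw [sub_eq_zero.1 h] at hz
        exact absurd (mem_sphere_zero_iff_norm.1 hz) (mem_ball_zero_iff.1 hwb).ne
      have hcont : Continuous fun ζ : Metric.sphere (0 : ℂ) 1 => ((ζ : ℂ) + w) / (ζ - w) := by
        fun_prop (disch := assumption)
      exact hcont.integrable_of_hasCompactSupport (HasCompactSupport.of_compactSpace _)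
    have hsing : ∫ ζ in {p}, ((ζ : ℂ) + w) / (ζ - w) ∂σ = σ.real {p} * ((1 + w) / (1 - w)) := by
      rw [integral_singleton, Complex.real_smul]
    have hcompl : I * ∫ ζ in {p}ᶜ, ((ζ : ℂ) + w) / (ζ - w) ∂σ =
        ∫ t : ℝ, (((t : ℂ) - z)⁻¹ - (t : ℂ) / ((t : ℂ) ^ 2 + 1)) ∂μ := by
      rw [integral_withDensity_eq_integral_toReal_smul hdm (Eventually.of_forall fun _ =>
        ENNReal.ofReal_lt_top), integral_map hT.aemeasurable, ← integral_const_mul]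
      · refine setIntegral_congr_fun (measurableSet_singleton p).compl fun ζ hζ => ?_
        have hζ1 : (ζ : ℂ) ≠ 1 := fun h => hζ (Subtype.ext h)
        have hTζ := ofReal_re_inverseCayley (mem_sphere_zero_iff_norm.1 ζ.2) hζ1
        rw [herglotzKernel_eq hz hζ1 hTζ]
        set t := (I * (1 + (ζ : ℂ)) / (1 - ζ)).re with ht
        have htz : (t : ℂ) - z ≠ 0 := by
          intro h
          rw [← sub_eq_zero.1 h] at hz
          simp at hz
        have hpos : 0 < t ^ 2 + 1 := by positivity
        have hpos' : (t : ℂ) ^ 2 + 1 ≠ 0 := by exact_mod_cast hpos.ne'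
        change _ = (ENNReal.ofReal (t ^ 2 + 1)).toReal •
          (((t : ℂ) - z)⁻¹ - (t : ℂ) / ((t : ℂ) ^ 2 + 1))
        rw [ENNReal.toReal_ofReal hpos.le, Complex.real_smul]
        push_cast
        field_simp
        ring
      · refine Measurable.aestronglyMeasurable ?_
        exact hdm.ennreal_toReal.smul (measurable_herglotzKernel z)
    have hz' : I * ((1 + w) / (1 - w)) = z := by
      rw [← mul_div_assoc]
      exact inverseCayley_cayley hz
    rw [hFz, hrep w hwb, ← integral_add_compl (measurableSet_singleton p) hInt, hsing,
      herglotzFn, ← hcompl, mul_add, mul_add]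
    have e1 : I * (σ.real {p} * ((1 + w) / (1 - w))) = σ.real {p} * z := by
      rw [← hz']
      ring
    have e2 : I * ((f 0).im * I) = ((-(f 0).im : ℝ) : ℂ) := by
      push_cast
      linear_combination ((f 0).im : ℂ) * I_mul_I
    rw [e1, e2, add_assoc]

end HalfPlane

lemma exists_isClosed_lintegral_sdiff_lt_top {E : Set ℝ} (hE : MeasurableSet E) {x : ℝ}
    (h : ∫⁻ t in Set.Ioo (x - 1) (x + 1) ∩ E, ENNReal.ofReal |t - x|⁻¹ ≠ ⊤) :
    ∃ W : Set ℝ, IsClosed W ∧ W ⊆ Metric.closedBall x 1 ∧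
      (∀ᵐ t : ℝ ∂(volume.restrict E), t ∉ W) ∧
      ∫⁻ t in Set.Ioo (x - 1) (x + 1) \ W, ENNReal.ofReal |t - x|⁻¹ ≠ ⊤ := by
  set J := Set.Ioo (x - 1) (x + 1)
  let A : ℕ → Set ℝ := fun n => {t | 1 / ((n : ℝ) + 1) < |t - x|}
  have hAo (n : ℕ) : IsOpen (A n) := isOpen_lt (by fun_prop) (by fun_prop)
  have hpos (n : ℕ) : (0 : ℝ) < (n : ℝ) + 1 := by positivity
  have hex (n : ℕ) : ∃ U, U ⊇ J ∩ E ∩ A n ∧ IsOpen U ∧ volume U < ⊤ ∧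
      volume (U \ (J ∩ E ∩ A n)) < ENNReal.ofReal ((1 / 2) ^ n / ((n : ℝ) + 1)) := by
    refine ((measurableSet_Ioo.inter hE).inter (hAo n).measurableSet).exists_isOpen_sdiff_lt ?_ ?_
    · refine ((measure_mono (Set.inter_subset_left.trans Set.inter_subset_left)).trans_lt ?_).ne
      exact measure_Ioo_lt_top
    · have := hpos n
      exact (ENNReal.ofReal_pos.2 (by positivity)).ne'
  choose U hsub hUo _ hUm using hex
  let V : Set ℝ := (⋃ n, U n ∩ A n) ∪ {t | 1 < |t - x|}
  have hVo : IsOpen V :=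
    (isOpen_iUnion fun n => (hUo n).inter (hAo n)).union (isOpen_lt (by fun_prop) (by fun_prop))
  refine ⟨Vᶜ, hVo.isClosed_compl, fun t ht => ?_, ?_, ?_⟩
  · rw [Metric.mem_closedBall, Real.dist_eq]
    by_contra hlt
    exact ht (Or.inr (not_le.1 hlt))
  · have hfin : ∀ᵐ t : ℝ, t ∉ ({x, x - 1, x + 1} : Set ℝ) :=
      measure_eq_zero_iff_ae_notMem.1 (Set.Finite.measure_zero (Set.toFinite _) _)
    filter_upwards [ae_restrict_of_ae hfin, ae_restrict_mem hE] with t ht htE hV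
    simp only [Set.mem_insert_iff, Set.mem_singleton_iff, not_or] at ht
    refine hV ?_
    rcases lt_or_ge 1 |t - x| with h1 | h1
    · exact Or.inr h1
    left
    obtain ⟨n, hn⟩ := exists_nat_one_div_lt (abs_pos.2 (sub_ne_zero.2 ht.1))
    rw [abs_le] at h1
    have hJ : t ∈ J := ⟨lt_of_le_of_ne (by linarith) (Ne.symm ht.2.1),
      lt_of_le_of_ne (by linarith) ht.2.2⟩
    exact Set.mem_iUnion.2 ⟨n, hsub n ⟨⟨hJ, htE⟩, hn⟩, hn⟩
  · have hcover : J \ Vᶜ ⊆ (J ∩ E) ∪ ⋃ n, (U n \ (J ∩ E ∩ A n)) ∩ A n := by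
      rintro t ⟨htJ, htV⟩
      rw [Set.notMem_compl_iff] at htV
      rcases htV with htV | htV
      · obtain ⟨n, htU, htA⟩ := Set.mem_iUnion.1 htV
        by_cases htE : t ∈ E
        · exact Or.inl ⟨htJ, htE⟩
        · exact Or.inr (Set.mem_iUnion.2 ⟨n, ⟨htU, fun h => htE h.1.2⟩, htA⟩)
      · have htV : 1 < |t - x| := htV
        have : |t - x| < 1 := abs_lt.2 ⟨by linarith [htJ.1], by linarith [htJ.2]⟩
        linarith
    refine ((lintegral_mono_set hcover).trans_lt ((lintegral_union_le _ _ _).trans_lt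
      (ENNReal.add_lt_top.2 ⟨h.lt_top, (lintegral_iUnion_le _ _).trans_lt ?_⟩))).ne
    have hn (n : ℕ) : ∫⁻ t in (U n \ (J ∩ E ∩ A n)) ∩ A n, ENNReal.ofReal |t - x|⁻¹ ≤
        ENNReal.ofReal ((1 / 2) ^ n) := by
      have hp := hpos n
      calc ∫⁻ t in (U n \ (J ∩ E ∩ A n)) ∩ A n, ENNReal.ofReal |t - x|⁻¹
          ≤ ∫⁻ t in (U n \ (J ∩ E ∩ A n)) ∩ A n, ENNReal.ofReal ((n : ℝ) + 1) := by
            refine setLIntegral_mono measurable_const fun t ht => ENNReal.ofReal_le_ofReal ?_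
            have : 1 / ((n : ℝ) + 1) < |t - x| := ht.2
            rw [← one_div]
            exact (one_div_lt hp (lt_trans (by positivity) this)).1 this |>.le
        _ ≤ ENNReal.ofReal ((n : ℝ) + 1) *
            ENNReal.ofReal ((1 / 2) ^ n / ((n : ℝ) + 1)) := by
            rw [setLIntegral_const]
            gcongr
            exact (measure_mono Set.inter_subset_left).trans (hUm n).le
        _ = ENNReal.ofReal ((1 / 2) ^ n) := by
            rw [← ENNReal.ofReal_mul hp.le]
            congr 1
            field_simp
    refine (ENNReal.tsum_le_tsum hn).trans_lt ?_
    rw [← ENNReal.ofReal_tsum_of_nonneg (fun n => by positivity) summable_geometric_two]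
    exact ENNReal.ofReal_lt_top

lemma div_sub_sq_add_sq_eq {y : ℝ} (hy : 0 < y) (u s : ℝ) :
    y / ((s - u) ^ 2 + y ^ 2) = y⁻¹ * (1 + ((s - u) / y) ^ 2)⁻¹ := by
  field_simp
  ring

lemma integrable_poissonKernel_line {y : ℝ} (hy : 0 < y) (u : ℝ) :
    Integrable fun s : ℝ => y / ((s - u) ^ 2 + y ^ 2) := by
  simp_rw [div_sub_sq_add_sq_eq hy]
  exact ((integrable_inv_one_add_sq.comp_div hy.ne').comp_sub_right u).const_mul _

lemma integral_poissonKernel_line {y : ℝ} (hy : 0 < y) (u : ℝ) :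
    ∫ s : ℝ, y / ((s - u) ^ 2 + y ^ 2) = Real.pi := by
  simp_rw [div_sub_sq_add_sq_eq hy]
  rw [integral_const_mul, integral_sub_right_eq_self (fun s => (1 + (s / y) ^ 2)⁻¹) u,
    Measure.integral_comp_div (fun s => (1 + s ^ 2)⁻¹), integral_univ_inv_one_add_sq,
    abs_of_pos hy, smul_eq_mul]
  field_simp

lemma cauchyTransform_im_le_pi {ν : Measure ℝ} [IsFiniteMeasure ν] (hν : ν ≤ volume) {z : ℂ}
    (hz : 0 < z.im) : (cauchyTransform ν z).im ≤ Real.pi := by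
  rw [cauchyTransform_im hz (Eventually.of_forall fun s => im_le_norm_ofReal_sub s z),
    ← integral_poissonKernel_line hz z.re]
  exact integral_mono_measure hν (Eventually.of_forall fun s => by dsimp only; positivity)
    (integrable_poissonKernel_line hz _)

lemma neg_log_le_integral_div_sq_add_sq {y : ℝ} (hy : 0 < y) :
    -Real.log y ≤ ∫ u in (0 : ℝ)..1, u / (u ^ 2 + y ^ 2) := by
  have hne (u : ℝ) : u ^ 2 + y ^ 2 ≠ 0 := by positivity
  have hd : ∀ u ∈ Set.uIcc (0 : ℝ) 1,
      HasDerivAt (fun u => 2⁻¹ * Real.log (u ^ 2 + y ^ 2)) (u / (u ^ 2 + y ^ 2)) u := by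
    intro u _
    have h1 : HasDerivAt (fun u : ℝ => u ^ 2 + y ^ 2) (2 * u) u := by
      simpa using (hasDerivAt_pow 2 u).add_const (y ^ 2)
    have h2 := (h1.log (hne u)).const_mul (2⁻¹ : ℝ)
    refine h2.congr_deriv ?_
    field_simp
  rw [intervalIntegral.integral_eq_sub_of_hasDerivAt hd
    (Continuous.intervalIntegrable (by fun_prop (disch := exact hne _)) _ _)]
  have h1 : 0 ≤ Real.log (1 ^ 2 + y ^ 2) := Real.log_nonneg (by nlinarith)
  have h2 : Real.log (0 ^ 2 + y ^ 2) = 2 * Real.log y := by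
    rw [zero_pow two_ne_zero, zero_add, Real.log_pow]
    norm_num
  rw [h2]
  generalize Real.log (1 ^ 2 + y ^ 2) = L at h1 ⊢
  linarith

lemma neg_two_mul_log_le_setIntegral {y : ℝ} (hy : 0 < y) (x : ℝ) :
    -(2 * Real.log y) ≤ ∫ s in Set.Ioo (x - 1) (x + 1), |s - x| / ((s - x) ^ 2 + y ^ 2) := by
  have hne (u : ℝ) : u ^ 2 + y ^ 2 ≠ 0 := by positivity
  have hii (a b : ℝ) : IntervalIntegrable (fun u : ℝ => |u| / (u ^ 2 + y ^ 2)) volume a b :=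
    Continuous.intervalIntegrable (by fun_prop (disch := exact hne _)) _ _
  rw [← integral_Ioc_eq_integral_Ioo, ← intervalIntegral.integral_of_le (by linarith),
    intervalIntegral.integral_comp_sub_right (fun u => |u| / (u ^ 2 + y ^ 2)) x,
    sub_sub_cancel_left, add_sub_cancel_left,
    ← intervalIntegral.integral_add_adjacent_intervals (hii (-1) 0) (hii 0 1)]
  have h1 : ∫ u in (0 : ℝ)..1, |u| / (u ^ 2 + y ^ 2) = ∫ u in (0 : ℝ)..1, u / (u ^ 2 + y ^ 2) := by
    refine intervalIntegral.integral_congr fun u hu => ?_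
    rw [Set.uIcc_of_le zero_le_one] at hu
    simp only [abs_of_nonneg hu.1]
  have h2 : ∫ u in (-1 : ℝ)..0, |u| / (u ^ 2 + y ^ 2) =
      ∫ u in (0 : ℝ)..1, |u| / (u ^ 2 + y ^ 2) := by
    have := intervalIntegral.integral_comp_neg (a := 0) (b := 1)
      fun u : ℝ => |u| / (u ^ 2 + y ^ 2)
    rw [neg_zero] at this
    rw [← this]
    simp
  rw [h2, h1]
  linarith [neg_log_le_integral_div_sq_add_sq hy]

/-- The function `I exp ((G₊ - G₋) / 2)`, where `G₊` and `G₋` are the Cauchy transforms of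
Lebesgue measure restricted to the parts of `W` to the right and to the left of `x`. -/
noncomputable def expCauchy (W : Set ℝ) (x : ℝ) (z : ℂ) : ℂ :=
  Complex.I * Complex.exp (2⁻¹ * (cauchyTransform (volume.restrict (W ∩ Set.Ioi x)) z -
    cauchyTransform (volume.restrict (W ∩ Set.Iio x)) z))

lemma isFiniteMeasure_restrict_inter {W : Set ℝ} {x : ℝ} (hW : W ⊆ Metric.closedBall x 1)
    (S : Set ℝ) : IsFiniteMeasure (volume.restrict (W ∩ S)) :=
  isFiniteMeasure_restrict.2
    ((measure_mono (Set.inter_subset_left.trans hW)).trans_lt measure_closedBall_lt_top).ne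

lemma differentiableOn_expCauchy {W : Set ℝ} {x : ℝ} (hW : W ⊆ Metric.closedBall x 1) :
    DifferentiableOn ℂ (expCauchy W x) {z | 0 < z.im} := by
  have := isFiniteMeasure_restrict_inter hW (Set.Ioi x)
  have := isFiniteMeasure_restrict_inter hW (Set.Iio x)
  exact (((differentiableOn_cauchyTransform.sub
    differentiableOn_cauchyTransform).const_mul _).cexp).const_mul _

lemma expCauchy_im_nonneg {W : Set ℝ} {x : ℝ} (hW : W ⊆ Metric.closedBall x 1) {z : ℂ}
    (hz : 0 < z.im) : 0 ≤ (expCauchy W x z).im := by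
  have := isFiniteMeasure_restrict_inter hW (Set.Ioi x)
  have := isFiniteMeasure_restrict_inter hW (Set.Iio x)
  have hp := cauchyTransform_im_nonneg (ν := volume.restrict (W ∩ Set.Ioi x)) hz
  have hm := cauchyTransform_im_nonneg (ν := volume.restrict (W ∩ Set.Iio x)) hz
  have hp' := cauchyTransform_im_le_pi (ν := volume.restrict (W ∩ Set.Ioi x))
    Measure.restrict_le_self hz
  have hm' := cauchyTransform_im_le_pi (ν := volume.restrict (W ∩ Set.Iio x))
    Measure.restrict_le_self hz
  rw [expCauchy, Complex.I_mul_im, Complex.exp_re]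
  refine mul_nonneg (Real.exp_nonneg _) (Real.cos_nonneg_of_mem_Icc ?_)
  have h : (2⁻¹ * (cauchyTransform (volume.restrict (W ∩ Set.Ioi x)) z -
      cauchyTransform (volume.restrict (W ∩ Set.Iio x)) z)).im =
      2⁻¹ * ((cauchyTransform (volume.restrict (W ∩ Set.Ioi x)) z).im -
      (cauchyTransform (volume.restrict (W ∩ Set.Iio x)) z).im) := by
    simp [Complex.mul_im]
  rw [h]
  constructor <;> linarith

lemma ae_restrict_le_norm_ofReal_sub {W S : Set ℝ} {t δ : ℝ} (hWm : MeasurableSet (W ∩ S))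
    (hδ : Disjoint (Metric.ball t δ) W) :
    ∀ᵐ s : ℝ ∂(volume.restrict (W ∩ S)), δ ≤ ‖(s : ℂ) - (t : ℂ)‖ := by
  filter_upwards [ae_restrict_mem hWm] with s hs
  rw [← Complex.ofReal_sub, Complex.norm_real, ← dist_eq_norm]
  by_contra h
  exact Set.disjoint_left.1 hδ (Metric.mem_ball.2 (not_le.1 h)) hs.1

lemma tendsto_expCauchy_re {W : Set ℝ} {x t : ℝ} (hWc : IsClosed W)
    (hW : W ⊆ Metric.closedBall x 1) (ht : t ∉ W) :
    Tendsto (fun y : ℝ => (expCauchy W x (t + y * Complex.I)).re) (𝓝[>] 0) (𝓝 0) := by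
  obtain ⟨δ, hδ, hball⟩ := Metric.isOpen_iff.1 hWc.isOpen_compl t ht
  have hdisj : Disjoint (Metric.ball t δ) W := Set.subset_compl_iff_disjoint_right.1 hball
  have := isFiniteMeasure_restrict_inter hW (Set.Ioi x)
  have := isFiniteMeasure_restrict_inter hW (Set.Iio x)
  have hp := ae_restrict_le_norm_ofReal_sub (hWc.measurableSet.inter measurableSet_Ioi
    : MeasurableSet (W ∩ Set.Ioi x)) hdisj
  have hm := ae_restrict_le_norm_ofReal_sub (hWc.measurableSet.inter measurableSet_Iio
    : MeasurableSet (W ∩ Set.Iio x)) hdisj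
  have hc : ContinuousAt (fun z => (expCauchy W x z).re) t :=
    Complex.continuous_re.continuousAt.comp
      ((((differentiableAt_cauchyTransform hδ hp).sub
        (differentiableAt_cauchyTransform hδ hm)).const_mul _).cexp.const_mul _).continuousAt
  have h0 : (expCauchy W x t).re = 0 := by
    have hp0 := cauchyTransform_im hδ hp
    have hm0 := cauchyTransform_im hδ hm
    simp only [Complex.ofReal_im, zero_div, integral_zero] at hp0 hm0
    rw [expCauchy, Complex.I_mul_re, Complex.exp_im]
    simp [Complex.mul_im, hp0, hm0]
  have hl : Tendsto (fun y : ℝ => (t : ℂ) + y * Complex.I) (𝓝[>] 0) (𝓝 t) := by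
    refine tendsto_nhdsWithin_of_tendsto_nhds ?_
    have : Continuous fun y : ℝ => (t : ℂ) + y * Complex.I := by fun_prop
    simpa using this.tendsto 0
  have := hc.tendsto.comp hl
  rwa [h0] at this

lemma integrableOn_abs_sub_div {y : ℝ} (hy : 0 < y) (x : ℝ) {S : Set ℝ}
    (hS : S ⊆ Metric.closedBall x 1) :
    IntegrableOn (fun s => |s - x| / ((s - x) ^ 2 + y ^ 2)) S := by
  have hne (s : ℝ) : (s - x) ^ 2 + y ^ 2 ≠ 0 := by positivity
  have : Continuous fun s => |s - x| / ((s - x) ^ 2 + y ^ 2) := by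
    fun_prop (disch := exact hne _)
  exact (this.continuousOn.integrableOn_compact (isCompact_closedBall x 1)).mono_set hS

lemma setIntegral_abs_sub_div_le {y x : ℝ} (hy : 0 < y) {S : Set ℝ}
    (hS : ∫⁻ t in S, ENNReal.ofReal |t - x|⁻¹ ≠ ⊤) :
    ∫ s in S, |s - x| / ((s - x) ^ 2 + y ^ 2) ≤
      (∫⁻ t in S, ENNReal.ofReal |t - x|⁻¹).toReal := by
  have hne (s : ℝ) : (s - x) ^ 2 + y ^ 2 ≠ 0 := by positivity
  have : Continuous fun s => |s - x| / ((s - x) ^ 2 + y ^ 2) := by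
    fun_prop (disch := exact hne _)
  rw [integral_eq_lintegral_of_nonneg_ae (Eventually.of_forall fun s => by positivity)
    this.aestronglyMeasurable]
  refine ENNReal.toReal_mono hS (lintegral_mono fun s => ENNReal.ofReal_le_ofReal ?_)
  rcases eq_or_ne s x with rfl | hs
  · simp
  have hpos : 0 < |s - x| := abs_pos.2 (sub_ne_zero.2 hs)
  rw [div_le_iff₀ (by positivity), inv_mul_eq_div, le_div_iff₀ hpos, ← sq, sq_abs]
  nlinarith

lemma re_cauchyTransform_sub_eq_setIntegral {W : Set ℝ} {x y : ℝ} (hWc : IsClosed W)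
    (hW : W ⊆ Metric.closedBall x 1) (hy : 0 < y) :
    (cauchyTransform (volume.restrict (W ∩ Set.Ioi x)) (x + y * Complex.I) -
      cauchyTransform (volume.restrict (W ∩ Set.Iio x)) (x + y * Complex.I)).re =
      ∫ s in W, |s - x| / ((s - x) ^ 2 + y ^ 2) := by
  have := isFiniteMeasure_restrict_inter hW (Set.Ioi x)
  have := isFiniteMeasure_restrict_inter hW (Set.Iio x)
  have him : ((x : ℂ) + y * Complex.I).im = y := by simp
  have hre : ((x : ℂ) + y * Complex.I).re = x := by simp
  have hd (s : ℝ) : y ≤ ‖(s : ℂ) - (x + y * Complex.I)‖ := by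
    simpa using im_le_norm_ofReal_sub s (x + y * Complex.I)
  have hWp : MeasurableSet (W ∩ Set.Ioi x) := hWc.measurableSet.inter measurableSet_Ioi
  have hWm : MeasurableSet (W ∩ Set.Iio x) := hWc.measurableSet.inter measurableSet_Iio
  rw [Complex.sub_re, cauchyTransform_re hy (Eventually.of_forall hd),
    cauchyTransform_re hy (Eventually.of_forall hd), him, hre]
  have hp : ∫ s in W ∩ Set.Ioi x, (s - x) / ((s - x) ^ 2 + y ^ 2) =
      ∫ s in W ∩ Set.Ioi x, |s - x| / ((s - x) ^ 2 + y ^ 2) :=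
    setIntegral_congr_fun hWp fun s hs => by
      simp only [abs_of_pos (sub_pos.2 (Set.mem_Ioi.1 hs.2))]
  have hm : -∫ s in W ∩ Set.Iio x, (s - x) / ((s - x) ^ 2 + y ^ 2) =
      ∫ s in W ∩ Set.Iio x, |s - x| / ((s - x) ^ 2 + y ^ 2) := by
    rw [← integral_neg]
    exact setIntegral_congr_fun hWm fun s hs => by
      simp only [abs_of_neg (sub_neg.2 (Set.mem_Iio.1 hs.2)), neg_div]
  rw [sub_eq_add_neg, hp, hm, ← setIntegral_union
    (Set.disjoint_left.2 fun s hs hs' => lt_asymm (Set.mem_Ioi.1 hs.2) (Set.mem_Iio.1 hs'.2)) hWm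
    (integrableOn_abs_sub_div hy x (Set.inter_subset_left.trans hW))
    (integrableOn_abs_sub_div hy x (Set.inter_subset_left.trans hW)), ← Set.inter_union_distrib_left,
    Set.union_comm, Set.Iio_union_Ioi]
  refine setIntegral_congr_set ?_
  rw [← Set.sdiff_eq]
  exact sdiff_null_ae_eq_self (measure_singleton x)

lemma exp_le_mul_norm_expCauchy {W : Set ℝ} {x y : ℝ} (hWc : IsClosed W)
    (hW : W ⊆ Metric.closedBall x 1) (hy : 0 < y)
    (h : ∫⁻ t in Set.Ioo (x - 1) (x + 1) \ W, ENNReal.ofReal |t - x|⁻¹ ≠ ⊤) :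
    Real.exp (-(2⁻¹ * (∫⁻ t in Set.Ioo (x - 1) (x + 1) \ W,
      ENNReal.ofReal |t - x|⁻¹).toReal)) ≤ ‖(y : ℂ) * expCauchy W x (x + y * Complex.I)‖ := by
  have hJ : Set.Ioo (x - 1) (x + 1) ⊆ Metric.closedBall x 1 := by
    rw [← Real.ball_eq_Ioo]
    exact Metric.ball_subset_closedBall
  have hlog := neg_two_mul_log_le_setIntegral hy x
  have hdiff := setIntegral_abs_sub_div_le hy h
  have hsplit := integral_inter_add_sdiff hWc.measurableSet (integrableOn_abs_sub_div hy x hJ)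
  have hinter : ∫ s in Set.Ioo (x - 1) (x + 1) ∩ W, |s - x| / ((s - x) ^ 2 + y ^ 2) ≤
      ∫ s in W, |s - x| / ((s - x) ^ 2 + y ^ 2) :=
    setIntegral_mono_set (integrableOn_abs_sub_div hy x hW)
      (Eventually.of_forall fun s => by dsimp only [Pi.zero_apply]; positivity)
      (Eventually.of_forall Set.inter_subset_right)
  rw [expCauchy, norm_mul, norm_mul, Complex.norm_I, one_mul, Complex.norm_exp,
    Complex.norm_real, Real.norm_of_nonneg hy.le]
  nth_rewrite 1 [← Real.exp_log hy]
  rw [← Real.exp_add, Real.exp_le_exp]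
  have hre (w : ℂ) : (2⁻¹ * w).re = 2⁻¹ * w.re := by simp [Complex.mul_re]
  rw [hre, re_cauchyTransform_sub_eq_setIntegral hWc hW hy]
  linarith

lemma exists_isReflectionless_measure_singleton_ne_zero {E : Set ℝ} (hE : MeasurableSet E)
    {x : ℝ} (h : ∫⁻ t in Set.Ioo (x - 1) (x + 1) ∩ E, ENNReal.ofReal |t - x|⁻¹ ≠ ⊤) :
    ∃ μ : Measure ℝ, IsReflectionless μ E ∧ μ {x} ≠ 0 := by
  obtain ⟨W, hWc, hW, hEW, hfin⟩ := exists_isClosed_lintegral_sdiff_lt_top hE h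
  obtain ⟨μ, a, b, hb, hμ, hF⟩ := exists_eq_herglotzFn (differentiableOn_expCauchy hW)
    fun z hz => expCauchy_im_nonneg hW hz
  have heq (t : ℝ) : ∀ᶠ y : ℝ in 𝓝[>] 0,
      expCauchy W x (t + y * Complex.I) = herglotzFn μ a b (t + y * Complex.I) := by
    filter_upwards [self_mem_nhdsWithin] with y hy
    exact hF _ (by simpa using hy)
  refine ⟨μ, ⟨hμ, a, b, hb, ?_⟩, fun h0 => ?_⟩
  · filter_upwards [hEW] with t ht
    exact (tendsto_expCauchy_re hWc hW ht).congr' ((heq t).mono fun y hy => by rw [hy])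
  · have hlim := (tendsto_mul_herglotzFn_of_measure_singleton_eq_zero hμ h0 a b).norm
    rw [norm_zero] at hlim
    refine absurd (ge_of_tendsto hlim ?_) (not_le.2 (Real.exp_pos (-(2⁻¹ *
      (∫⁻ t in Set.Ioo (x - 1) (x + 1) \ W, ENNReal.ofReal |t - x|⁻¹).toReal))))
    filter_upwards [heq x, self_mem_nhdsWithin] with y hy hy0
    rw [← hy]
    exact exp_le_mul_norm_expCauchy hWc hW hy0 hfin

/-- Theorem 1.2: for a Borel set `E ⊂ ℝ` and a point `x ∈ ℝ`, every measure `μ ∈ R(E)`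
satisfies `μ({x}) = 0` if and only if `∫_{x-1}^{x+1} χ_E(t)/|t-x| dt = ∞`. -/
theorem no_point_mass_iff_divergent_integral
    (E : Set ℝ) (hE : MeasurableSet E) (x : ℝ) :
    (∀ μ : Measure ℝ, IsReflectionless μ E → μ {x} = 0) ↔
      ∫⁻ t in Set.Ioo (x - 1) (x + 1) ∩ E, ENNReal.ofReal |t - x|⁻¹ = ⊤ := by
  refine ⟨fun ha => ?_, fun hb μ hμ => ?_⟩
  · by_contra h
    obtain ⟨μ, hμ, hx⟩ := exists_isReflectionless_measure_singleton_ne_zero hE h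
    exact hx (ha μ hμ)
  · obtain ⟨hInt, a, b, -, href⟩ := hμ
    by_contra h0
    have hfin : μ {x} ≠ ⊤ := ((measure_mono (Set.singleton_subset_iff.2
      (Metric.mem_closedBall_self zero_le_one))).trans_lt
      (measure_closedBall_lt_top_of_integrable hInt x 1)).ne
    exact (lintegral_lt_top_of_measure_singleton_pos hInt
      (ENNReal.toReal_pos h0 hfin) href).ne hb
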